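/- Let Λ be a finite dimensional algebra over a field K. The assignment (M,P) ↦ (M,P)† = (Tr M_np ⊕ P*, M_p*) is a bijection between the set of isomorphism classes of basic Gorenstein projective support τ-tilting pairs in mod Λ and the set of isomorphism classes of basic Gorenstein projective support τ-tilting pairs in mod Λ^op. -/

import Mathlib

/-!  Common definitions: Gorenstein projective/injective modules, transpose,
Auslander–Reiten translation, τ-rigid and τ-tilting modules and pairs,
torsion pairs, etc., over a finite dimensional algebra.
Throughout, "mod Λ" is modelled by the category of finitely generated
(left) modules over a finite dimensional `K`-algebra `R`, and
"mod Λᵒᵖ" by finitely generated `Rᵐᵒᵖ`-modules. -/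

universe u

open Function MulOpposite

namespace GPTau

section Ring

variable (R : Type u) [Ring R]

/-- A submodule `N ≤ M` is superfluous (small) if `N ⊔ N' = ⊤` implies `N' = ⊤`. -/
def IsSuperfluous {M : Type u} [AddCommGroup M] [Module R M] (N : Submodule R M) : Prop :=
  ∀ N' : Submodule R M, N ⊔ N' = ⊤ → N' = ⊤

/-- `M` is Gorenstein projective: there is a doubly infinite exact sequence of
finitely generated projective modules which stays exact under `Hom(-, R)` and
such that `M ≅ Im (P₋₁ → P₀)`. -/
def IsGP (M : Type u) [AddCommGroup M] [Module R M] : Prop :=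
  ∃ (P : ℤ → Type u) (_ : ∀ n, AddCommGroup (P n)) (_ : ∀ n, Module R (P n))
    (d : ∀ n : ℤ, P n →ₗ[R] P (n + 1)),
    (∀ n, Module.Finite R (P n)) ∧
    (∀ n, Module.Projective R (P n)) ∧
    (∀ n, Function.Exact (d n) (d (n + 1))) ∧
    (∀ n, Function.Exact
      (fun g : P (n + 1 + 1) →ₗ[R] R => g.comp (d (n + 1)))
      (fun g : P (n + 1) →ₗ[R] R => g.comp (d n))) ∧
    Nonempty (M ≃ₗ[R] LinearMap.range (d (-1)))

/-- A linear map factors through a (finitely generated) projective module. -/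
def FactorsThroughProj {A B : Type u} [AddCommGroup A] [Module R A]
    [AddCommGroup B] [Module R B] (f : A →ₗ[R] B) : Prop :=
  ∃ (Q : Type u) (_ : AddCommGroup Q) (_ : Module R Q),
    Module.Projective R Q ∧ ∃ (a : A →ₗ[R] Q) (b : Q →ₗ[R] B), b.comp a = f

/-- Two maps are equal in the stable category (mod projectives). -/
def StEq {A B : Type u} [AddCommGroup A] [Module R A] [AddCommGroup B] [Module R B]
    (f g : A →ₗ[R] B) : Prop :=
  FactorsThroughProj R (f - g)

/-- An indecomposable module. -/
def IsIndec (M : Type u) [AddCommGroup M] [Module R M] : Prop :=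
  Nontrivial M ∧ ∀ N₁ N₂ : Submodule R M, IsCompl N₁ N₂ → N₁ = ⊥ ∨ N₂ = ⊥

/-- `|M| = k` : `M` decomposes into indecomposable direct summands having
exactly `k` isomorphism classes. -/
def NumIndec (M : Type u) [AddCommGroup M] [Module R M] (k : ℕ) : Prop :=
  ∃ (n : ℕ) (N : Fin n → Submodule R M),
    DirectSum.IsInternal N ∧ (∀ i, IsIndec R (N i)) ∧
    ∃ c : Fin n → Fin k, Surjective c ∧
      ∀ i j, (c i = c j ↔ Nonempty ((N i) ≃ₗ[R] (N j)))

/-- A basic module: it is a direct sum of pairwise nonisomorphic indecomposables. -/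
def IsBasic (M : Type u) [AddCommGroup M] [Module R M] : Prop :=
  ∃ (n : ℕ) (N : Fin n → Submodule R M),
    DirectSum.IsInternal N ∧ (∀ i, IsIndec R (N i)) ∧
    ∀ i j, i ≠ j → ¬ Nonempty ((N i) ≃ₗ[R] (N j))

/-- `M` has no nonzero projective direct summand. -/
def NoProjSummand (M : Type u) [AddCommGroup M] [Module R M] : Prop :=
  ∀ N₁ N₂ : Submodule R M, IsCompl N₁ N₂ → Module.Projective R N₁ → N₁ = ⊥

/-- `X` is a direct summand of `T`. -/
def IsDirectSummand (X T : Type u) [AddCommGroup X] [Module R X]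
    [AddCommGroup T] [Module R T] : Prop :=
  ∃ (i : X →ₗ[R] T) (p : T →ₗ[R] X), p.comp i = LinearMap.id

/-- `Ext¹(X, Y) = 0`: every short exact sequence `0 → Y → E → X → 0` splits. -/
def Ext1Vanishes (X Y : Type u) [AddCommGroup X] [Module R X]
    [AddCommGroup Y] [Module R Y] : Prop :=
  ∀ (E : Type u) [AddCommGroup E] [Module R E] (i : Y →ₗ[R] E) (p : E →ₗ[R] X),
    Injective i → Surjective p → Function.Exact i p →
    ∃ s : X →ₗ[R] E, p.comp s = LinearMap.id

/-- `X ∈ Fac G`: `X` is a quotient of a finite direct sum of copies of `G`. -/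
def FacOf (G X : Type u) [AddCommGroup G] [Module R G] [AddCommGroup X] [Module R X] : Prop :=
  ∃ (n : ℕ) (p : (Fin n → G) →ₗ[R] X), Surjective p

/-- `X ∈ Sub C`: `X` embeds into a finite direct sum of copies of `C`. -/
def SubOf (C X : Type u) [AddCommGroup C] [Module R C] [AddCommGroup X] [Module R X] : Prop :=
  ∃ (n : ℕ) (i : X →ₗ[R] (Fin n → C)), Injective i

/-- `X ∈ add G`: `X` is a direct summand of a finite direct sum of copies of `G`. -/
def InAdd (G X : Type u) [AddCommGroup G] [Module R G] [AddCommGroup X] [Module R X] : Prop :=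
  ∃ (n : ℕ) (i : X →ₗ[R] (Fin n → G)) (p : (Fin n → G) →ₗ[R] X), p.comp i = LinearMap.id

/-- The Jacobson radical of `R` (as a left ideal). -/
def JacobsonRad : Ideal R := (⊥ : Ideal R).jacobson

/-- The Jacobson radical squares to zero. -/
def RadSquareZero : Prop :=
  ∀ x y : R, x ∈ JacobsonRad R → y ∈ JacobsonRad R → x * y = 0

/-- A uniserial module: its submodules form a chain. -/
def IsUniserial (M : Type u) [AddCommGroup M] [Module R M] : Prop :=
  ∀ N₁ N₂ : Submodule R M, N₁ ≤ N₂ ∨ N₂ ≤ N₁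

/-- `R` has finite global dimension: there is `n` such that every finitely
generated module has a projective resolution vanishing in degrees `> n`. -/
def FiniteGlobalDimension : Prop :=
  ∃ n : ℕ, ∀ (M : Type u) [AddCommGroup M] [Module R M], Module.Finite R M →
    ∃ (P : ℕ → Type u) (_ : ∀ i, AddCommGroup (P i)) (_ : ∀ i, Module R (P i))
      (d : ∀ i : ℕ, P (i + 1) →ₗ[R] P i) (ε : P 0 →ₗ[R] M),
      (∀ i, Module.Projective R (P i)) ∧ Surjective ε ∧
      Function.Exact (d 0) ε ∧ (∀ i, Function.Exact (d (i + 1)) (d i)) ∧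
      (∀ i, n < i → Subsingleton (P i))

/-- The injective dimension of `R` as a module over itself is at most 1. -/
def SelfInjDimLE1 : Prop :=
  ∃ (I₀ I₁ : Type u) (_ : AddCommGroup I₀) (_ : Module R I₀)
    (_ : AddCommGroup I₁) (_ : Module R I₁),
    Module.Finite R I₀ ∧ Module.Finite R I₁ ∧
    Module.Injective R I₀ ∧ Module.Injective R I₁ ∧
    ∃ (i : R →ₗ[R] I₀) (p : I₀ →ₗ[R] I₁),
      Injective i ∧ Surjective p ∧ Function.Exact i p

end Ring

section Algebra

variable (R : Type u) [Ring R] (K : Type u) [Field K] [Algebra K R]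

/-- For an algebra over a field, the scalars of the base field commute with the
ring action on any compatible module. -/
instance (priority := 100) smulCommClass_of_tower (M : Type u) [AddCommGroup M]
    [Module R M] [Module K M] [IsScalarTower K R M] : SMulCommClass R K M :=
  ⟨fun r k m => by
    rw [← algebraMap_smul R k m, ← mul_smul, ← Algebra.commutes, mul_smul, algebraMap_smul]⟩

end Algebra

section OpDual

variable (R : Type u) [Ring R] (K : Type u) [Field K] [Algebra K R]
variable (M : Type u) [AddCommGroup M] [Module Rᵐᵒᵖ M] [Module K M]
  [IsScalarTower K Rᵐᵒᵖ M]

/-- The `K`-dual of a (finitely generated) `Rᵐᵒᵖ`-module, as an `R`-module: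
this is the duality `D : mod Λᵒᵖ → mod Λ`. -/
def OpDual (R : Type u) [Ring R] (K : Type u) [Field K] [Algebra K R]
    (M : Type u) [AddCommGroup M] [Module Rᵐᵒᵖ M] [Module K M]
    [IsScalarTower K Rᵐᵒᵖ M] : Type u := M →ₗ[K] K

instance : AddCommGroup (OpDual R K M) := inferInstanceAs (AddCommGroup (M →ₗ[K] K))

instance : Module K (OpDual R K M) := inferInstanceAs (Module K (M →ₗ[K] K))

/-- Scalar action `x ↦ op r • x` as a `K`-linear map. -/
def opSmulHom (r : R) : M →ₗ[K] M where
  toFun x := op r • x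
  map_add' x y := smul_add _ x y
  map_smul' k x := smul_comm (op r) k x

/-- Reinterpret an element of the dual as a linear functional. -/
def OpDual.toL (f : OpDual R K M) : M →ₗ[K] K := f

lemma OpDual.toL_injective :
    Function.Injective (OpDual.toL R K M) := fun _ _ h => h

instance : SMul R (OpDual R K M) :=
  ⟨fun r f => ((OpDual.toL R K M f).comp (opSmulHom R K M r) : M →ₗ[K] K)⟩

lemma OpDual.smul_toL (r : R) (f : OpDual R K M) (x : M) :
    OpDual.toL R K M (r • f) x = OpDual.toL R K M f (op r • x) := rfl

lemma OpDual.toL_add (f g : OpDual R K M) :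
    OpDual.toL R K M (f + g) = OpDual.toL R K M f + OpDual.toL R K M g := rfl

lemma OpDual.toL_zero : OpDual.toL R K M 0 = 0 := rfl

instance : Module R (OpDual R K M) where
  one_smul f := OpDual.toL_injective R K M <| LinearMap.ext fun x => by
    rw [OpDual.smul_toL, op_one, one_smul]
  mul_smul r s f := OpDual.toL_injective R K M <| LinearMap.ext fun x => by
    rw [OpDual.smul_toL, OpDual.smul_toL, OpDual.smul_toL, op_mul, mul_smul]
  smul_zero r := OpDual.toL_injective R K M <| LinearMap.ext fun x => by
    rw [OpDual.smul_toL, OpDual.toL_zero]; simp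
  smul_add r f g := OpDual.toL_injective R K M <| LinearMap.ext fun x => by
    rw [OpDual.smul_toL, OpDual.toL_add]
    simp only [LinearMap.add_apply, OpDual.toL_add]
    rw [OpDual.smul_toL, OpDual.smul_toL]
  add_smul r s f := OpDual.toL_injective R K M <| LinearMap.ext fun x => by
    rw [OpDual.smul_toL]
    simp only [OpDual.toL_add, LinearMap.add_apply]
    rw [OpDual.smul_toL, OpDual.smul_toL, op_add, add_smul, map_add]
  zero_smul f := OpDual.toL_injective R K M <| LinearMap.ext fun x => by
    rw [OpDual.smul_toL, OpDual.toL_zero, op_zero, zero_smul, map_zero]; rfl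

instance : IsScalarTower K R (OpDual R K M) :=
  ⟨fun k r f => OpDual.toL_injective R K M <| LinearMap.ext fun x => by
    have h1 : OpDual.toL R K M ((k • r) • f) x = OpDual.toL R K M f (op (k • r) • x) := rfl
    have h2 : OpDual.toL R K M (k • (r • f)) x = k • OpDual.toL R K M f (op r • x) := rfl
    rw [h1, h2, op_smul, smul_assoc, map_smul]⟩

end OpDual

section LDual

variable (R : Type u) [Ring R] (K : Type u) [Field K] [Algebra K R]
variable (M : Type u) [AddCommGroup M] [Module R M] [Module K M]
  [IsScalarTower K R M]

/-- The `K`-dual of a (finitely generated) `R`-module, as an `Rᵐᵒᵖ`-module: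
this is the duality `D : mod Λ → mod Λᵒᵖ`. -/
def LDual (R : Type u) [Ring R] (K : Type u) [Field K] [Algebra K R]
    (M : Type u) [AddCommGroup M] [Module R M] [Module K M]
    [IsScalarTower K R M] : Type u := M →ₗ[K] K

instance : AddCommGroup (LDual R K M) := inferInstanceAs (AddCommGroup (M →ₗ[K] K))

instance : Module K (LDual R K M) := inferInstanceAs (Module K (M →ₗ[K] K))

/-- Scalar action `x ↦ r • x` as a `K`-linear map. -/
def lSmulHom (r : R) : M →ₗ[K] M where
  toFun x := r • x
  map_add' x y := smul_add _ x y
  map_smul' k x := smul_comm r k x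

/-- Reinterpret an element of the dual as a linear functional. -/
def LDual.toL (f : LDual R K M) : M →ₗ[K] K := f

lemma LDual.toL_injective : Function.Injective (LDual.toL R K M) := fun _ _ h => h

instance : SMul Rᵐᵒᵖ (LDual R K M) :=
  ⟨fun s f => ((LDual.toL R K M f).comp (lSmulHom R K M (unop s)) : M →ₗ[K] K)⟩

lemma LDual.smul_toL (s : Rᵐᵒᵖ) (f : LDual R K M) (x : M) :
    LDual.toL R K M (s • f) x = LDual.toL R K M f (unop s • x) := rfl

lemma LDual.toL_add (f g : LDual R K M) :
    LDual.toL R K M (f + g) = LDual.toL R K M f + LDual.toL R K M g := rfl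

lemma LDual.toL_zero : LDual.toL R K M 0 = 0 := rfl

instance : Module Rᵐᵒᵖ (LDual R K M) where
  one_smul f := LDual.toL_injective R K M <| LinearMap.ext fun x => by
    rw [LDual.smul_toL, unop_one, one_smul]
  mul_smul s t f := LDual.toL_injective R K M <| LinearMap.ext fun x => by
    rw [LDual.smul_toL, LDual.smul_toL, LDual.smul_toL, unop_mul, mul_smul]
  smul_zero s := LDual.toL_injective R K M <| LinearMap.ext fun x => by
    rw [LDual.smul_toL, LDual.toL_zero]; simp
  smul_add s f g := LDual.toL_injective R K M <| LinearMap.ext fun x => by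
    rw [LDual.smul_toL, LDual.toL_add]
    simp only [LinearMap.add_apply, LDual.toL_add]
    rw [LDual.smul_toL, LDual.smul_toL]
  add_smul s t f := LDual.toL_injective R K M <| LinearMap.ext fun x => by
    rw [LDual.smul_toL]
    simp only [LDual.toL_add, LinearMap.add_apply]
    rw [LDual.smul_toL, LDual.smul_toL, unop_add, add_smul, map_add]
  zero_smul f := LDual.toL_injective R K M <| LinearMap.ext fun x => by
    rw [LDual.smul_toL, LDual.toL_zero, unop_zero, zero_smul, map_zero]; rfl

instance : IsScalarTower K Rᵐᵒᵖ (LDual R K M) :=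
  ⟨fun k s f => LDual.toL_injective R K M <| LinearMap.ext fun x => by
    have h1 : LDual.toL R K M ((k • s) • f) x = LDual.toL R K M f (unop (k • s) • x) := rfl
    have h2 : LDual.toL R K M (k • (s • f)) x = k • LDual.toL R K M f (unop s • x) := rfl
    rw [h1, h2, unop_smul, smul_assoc, map_smul]⟩

end LDual

section GI

variable (R : Type u) [Ring R] (K : Type u) [Field K] [Algebra K R]

/-- `M` is Gorenstein injective: there is a doubly infinite exact sequence of
finitely generated injective modules which stays exact under `Hom(DΛ, -)` and
such that `M ≅ Im (I₋₁ → I₀)`. Here `DΛ = OpDual R K R` is the `K`-dual of the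
regular module. -/
def IsGI (M : Type u) [AddCommGroup M] [Module R M] : Prop :=
  ∃ (I : ℤ → Type u) (_ : ∀ n, AddCommGroup (I n)) (_ : ∀ n, Module R (I n))
    (d : ∀ n : ℤ, I n →ₗ[R] I (n + 1)),
    (∀ n, Module.Finite R (I n)) ∧
    (∀ n, Module.Injective R (I n)) ∧
    (∀ n, Function.Exact (d n) (d (n + 1))) ∧
    (∀ n, Function.Exact
      (fun g : OpDual R K R →ₗ[R] I n => (d n).comp g)
      (fun g : OpDual R K R →ₗ[R] I (n + 1) => (d (n + 1)).comp g)) ∧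
    Nonempty (M ≃ₗ[R] LinearMap.range (d (-1)))

end GI

section MinPres

variable (R : Type u) [Ring R]

/-- A minimal projective presentation `P₁ → P₀ → M → 0`. -/
structure MinPres (M : Type u) [AddCommGroup M] [Module R M] : Type (u + 1) where
  P₁ : Type u
  P₀ : Type u
  [acg₁ : AddCommGroup P₁]
  [acg₀ : AddCommGroup P₀]
  [mod₁ : Module R P₁]
  [mod₀ : Module R P₀]
  fin₁ : Module.Finite R P₁
  fin₀ : Module.Finite R P₀
  proj₁ : Module.Projective R P₁
  proj₀ : Module.Projective R P₀
  d : P₁ →ₗ[R] P₀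
  p : P₀ →ₗ[R] M
  surj : Function.Surjective p
  exact : Function.Exact d p
  min₀ : IsSuperfluous R (LinearMap.ker p)
  min₁ : IsSuperfluous R (LinearMap.ker d)

attribute [instance] MinPres.acg₁ MinPres.acg₀ MinPres.mod₁ MinPres.mod₀

variable {R}
variable {M : Type u} [AddCommGroup M] [Module R M] (pr : MinPres R M)

/-- The map `Hom(P₀, R) → Hom(P₁, R)` dual to `d`, as a map of `Rᵐᵒᵖ`-modules. -/
def MinPres.dualMap : (pr.P₀ →ₗ[R] R) →ₗ[Rᵐᵒᵖ] (pr.P₁ →ₗ[R] R) where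
  toFun g := g.comp pr.d
  map_add' g h := by ext x; simp
  map_smul' s g := by ext x; simp

/-- The transpose `Tr M = Coker (Hom(P₀, R) → Hom(P₁, R))`, an `Rᵐᵒᵖ`-module. -/
def MinPres.Tr : Type u := (pr.P₁ →ₗ[R] R) ⧸ LinearMap.range pr.dualMap

instance : AddCommGroup pr.Tr :=
  inferInstanceAs (AddCommGroup ((pr.P₁ →ₗ[R] R) ⧸ LinearMap.range pr.dualMap))

instance : Module Rᵐᵒᵖ pr.Tr :=
  inferInstanceAs (Module Rᵐᵒᵖ ((pr.P₁ →ₗ[R] R) ⧸ LinearMap.range pr.dualMap))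

/-- The canonical projection onto the transpose. -/
def MinPres.toTr (h : pr.P₁ →ₗ[R] R) : pr.Tr :=
  Submodule.Quotient.mk (p := LinearMap.range pr.dualMap) h

section TauDef

variable (K : Type u) [Field K] [Algebra K R]

instance : Module K pr.Tr :=
  inferInstanceAs (Module K ((pr.P₁ →ₗ[R] R) ⧸ LinearMap.range pr.dualMap))

instance : IsScalarTower K Rᵐᵒᵖ pr.Tr :=
  inferInstanceAs
    (IsScalarTower K Rᵐᵒᵖ ((pr.P₁ →ₗ[R] R) ⧸ LinearMap.range pr.dualMap))

/-- The Auslander–Reiten translate `τM = D (Tr M)`, an `R`-module. -/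
def MinPres.tau : Type u := OpDual R K pr.Tr

instance : AddCommGroup (pr.tau K) := inferInstanceAs (AddCommGroup (OpDual R K pr.Tr))

instance : Module R (pr.tau K) := inferInstanceAs (Module R (OpDual R K pr.Tr))

instance : Module K (pr.tau K) := inferInstanceAs (Module K (OpDual R K pr.Tr))

instance : IsScalarTower K R (pr.tau K) :=
  inferInstanceAs (IsScalarTower K R (OpDual R K pr.Tr))

end TauDef

end MinPres

section Tau

variable (R : Type u) [Ring R] (K : Type u) [Field K] [Algebra K R]

/-- `M` is τ-rigid: `Hom(M, τM) = 0`. -/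
def IsTauRigid (M : Type u) [AddCommGroup M] [Module R M] : Prop :=
  ∀ pr : MinPres R M, ∀ f : M →ₗ[R] pr.tau K, f = 0

/-- `N ∈ ⊥(τM)`, i.e. `Hom(N, τM) = 0`. -/
def InPerpTau (M : Type u) [AddCommGroup M] [Module R M]
    (N : Type u) [AddCommGroup N] [Module R N] : Prop :=
  ∀ pr : MinPres R M, ∀ f : N →ₗ[R] pr.tau K, f = 0

/-- `M` is a τ-tilting module: τ-rigid with `|M| = |R|`. -/
def IsTauTilting (M : Type u) [AddCommGroup M] [Module R M] : Prop :=
  IsTauRigid R K M ∧ ∃ m l : ℕ, NumIndec R M m ∧ NumIndec R R l ∧ m = l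

/-- `M` is τ⁻¹-rigid: `Hom(τ⁻¹M, M) = 0`, where `τ⁻¹M = Tr (D M)`.
A homomorphism `τ⁻¹M → M` is an additive map compatible with the identification
`R ≅ Rᵐᵒᵖᵐᵒᵖ` of scalars. -/
def IsTauInvRigid (M : Type u) [AddCommGroup M] [Module R M] [Module K M]
    [IsScalarTower K R M] : Prop :=
  ∀ pr : MinPres Rᵐᵒᵖ (LDual R K M), ∀ f : pr.Tr →+ M,
    (∀ (r : R) (x : pr.Tr), f (op (op r) • x) = r • f x) → f = 0

/-- `M` is a τ⁻¹-tilting module. -/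
def IsTauInvTilting (M : Type u) [AddCommGroup M] [Module R M] [Module K M]
    [IsScalarTower K R M] : Prop :=
  IsTauInvRigid R K M ∧ ∃ m l : ℕ, NumIndec R M m ∧ NumIndec R R l ∧ m = l

end Tau

section Pairs

variable (K : Type u) [Field K] (R : Type u) [Ring R] [Algebra K R]

/-- A pair `(M, P)` of finitely generated modules (with compatible `K`-structure). -/
structure ModPair : Type (u + 1) where
  M : Type u
  [acgM : AddCommGroup M]
  [modM : Module R M]
  [modKM : Module K M]
  [towM : IsScalarTower K R M]
  finM : Module.Finite R M
  P : Type u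
  [acgP : AddCommGroup P]
  [modP : Module R P]
  [modKP : Module K P]
  [towP : IsScalarTower K R P]
  finP : Module.Finite R P

attribute [instance] ModPair.acgM ModPair.modM ModPair.modKM ModPair.towM
attribute [instance] ModPair.acgP ModPair.modP ModPair.modKP ModPair.towP

variable {K R}

/-- Isomorphism of pairs. -/
def ModPair.Iso (x y : ModPair K R) : Prop :=
  Nonempty (x.M ≃ₗ[R] y.M) ∧ Nonempty (x.P ≃ₗ[R] y.P)

variable (K R)

/-- The setoid of pairs satisfying a property `Q`, up to isomorphism. -/
def pairSetoid (Q : ModPair K R → Prop) : Setoid {x : ModPair K R // Q x} where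
  r a b := ModPair.Iso a.1 b.1
  iseqv := by
    constructor
    · exact fun a => ⟨⟨LinearEquiv.refl R a.1.M⟩, ⟨LinearEquiv.refl R a.1.P⟩⟩
    · rintro a b ⟨⟨e⟩, ⟨e'⟩⟩; exact ⟨⟨e.symm⟩, ⟨e'.symm⟩⟩
    · rintro a b c ⟨⟨e⟩, ⟨e'⟩⟩ ⟨⟨f⟩, ⟨f'⟩⟩; exact ⟨⟨e.trans f⟩, ⟨e'.trans f'⟩⟩

/-- `(M, P)` is a τ-rigid pair: `M` is τ-rigid, `P` is projective and `Hom(P, M) = 0`. -/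
def IsTauRigidPair (x : ModPair K R) : Prop :=
  IsTauRigid R K x.M ∧ Module.Projective R x.P ∧ ∀ f : x.P →ₗ[R] x.M, f = 0

/-- A Gorenstein projective τ-rigid pair. -/
def IsGPTauRigidPair (x : ModPair K R) : Prop :=
  IsTauRigidPair K R x ∧ IsGP R x.M

/-- A support τ-tilting pair: a τ-rigid pair with `|M| + |P| = |R|`. -/
def IsSuppTauTiltingPair (x : ModPair K R) : Prop :=
  IsTauRigidPair K R x ∧
    ∃ m p l : ℕ, NumIndec R x.M m ∧ NumIndec R x.P p ∧ NumIndec R R l ∧ m + p = l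

/-- A Gorenstein projective support τ-tilting pair. -/
def IsGPSuppTauTiltingPair (x : ModPair K R) : Prop :=
  IsSuppTauTiltingPair K R x ∧ IsGP R x.M

/-- `(I, N)` is a τ⁻¹-rigid pair; here `x.M = N` is the module and `x.P = I` is
injective, with `Hom(N, I) = 0`. -/
def IsTauInvRigidPair (x : ModPair K R) : Prop :=
  IsTauInvRigid R K x.M ∧ Module.Injective R x.P ∧ ∀ f : x.M →ₗ[R] x.P, f = 0

/-- A Gorenstein injective τ⁻¹-rigid pair. -/
def IsGITauInvRigidPair (x : ModPair K R) : Prop :=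
  IsTauInvRigidPair K R x ∧ IsGI R K x.M

/-- A support τ⁻¹-tilting pair: a τ⁻¹-rigid pair with `|N| + |I| = |R|`. -/
def IsSuppTauInvTiltingPair (x : ModPair K R) : Prop :=
  IsTauInvRigidPair K R x ∧
    ∃ m p l : ℕ, NumIndec R x.M m ∧ NumIndec R x.P p ∧ NumIndec R R l ∧ m + p = l

/-- A Gorenstein injective support τ⁻¹-tilting pair. -/
def IsGISuppTauInvTiltingPair (x : ModPair K R) : Prop :=
  IsSuppTauInvTiltingPair K R x ∧ IsGI R K x.M

/-- A basic pair. -/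
def IsBasicPair (x : ModPair K R) : Prop := IsBasic R x.M ∧ IsBasic R x.P

/-- `y` is (a representative of) the dagger `(M, P)† = (Tr M_np ⊕ P*, M_p*)` of `x`,
where `M = M_p ⊕ M_np` with `M_p` a maximal projective direct summand. -/
def IsDaggerOf (x : ModPair K R) (y : ModPair K Rᵐᵒᵖ) : Prop :=
  ∃ Mp Mnp : Submodule R x.M, IsCompl Mp Mnp ∧ Module.Projective R Mp ∧
    NoProjSummand R Mnp ∧
    ∃ pr : MinPres R Mnp,
      Nonempty (y.M ≃ₗ[Rᵐᵒᵖ] (pr.Tr × (x.P →ₗ[R] R))) ∧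
      Nonempty (y.P ≃ₗ[Rᵐᵒᵖ] (Mp →ₗ[R] R))

/-- `y` is (a representative of) `D((M, P)†)`, the Gorenstein injective pair
`(D(M_p*), D(Tr M_np ⊕ P*))` associated to `x`; in our convention `y.M` is the
τ⁻¹-rigid module `D(Tr M_np ⊕ P*)` and `y.P` is the injective module `D(M_p*)`. -/
def IsDDaggerOf (x : ModPair K R) (y : ModPair K R) : Prop :=
  ∃ z : ModPair K Rᵐᵒᵖ, IsDaggerOf K R x z ∧
    Nonempty (y.M ≃ₗ[R] OpDual R K z.M) ∧ Nonempty (y.P ≃ₗ[R] OpDual R K z.P)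

end Pairs

section Support

variable (R : Type u) [Ring R] (K : Type u) [Field K] [Algebra K R]

/-- `φ : R →+* S` realizes `S` as the quotient of `R` by the two-sided ideal
generated by `e` (universal property). -/
def IsQuotientByIdem (e : R) (S : Type u) [Ring S] (φ : R →+* S) : Prop :=
  Function.Surjective φ ∧ φ e = 0 ∧
    ∀ (S' : Type u) (_ : Ring S') (ψ : R →+* S'), ψ e = 0 → ∃ χ : S →+* S', χ.comp φ = ψ

/-- `M` is a support τ-tilting module: `M` is a τ-tilting module over `Λ/(e)` for
some idempotent `e`. -/
def IsSuppTauTilting (M : Type u) [AddCommGroup M] [Module R M] : Prop :=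
  ∃ e : R, IsIdempotentElem e ∧
    ∃ (S : Type u) (_ : Ring S) (_ : Algebra K S) (φ : R →+* S),
      (∀ k : K, φ (algebraMap K R k) = algebraMap K S k) ∧
      IsQuotientByIdem R e S φ ∧
      ∃ _ : Module S M, (∀ (r : R) (m : M), φ r • m = r • m) ∧ IsTauTilting S K M

/-- `M` is a support τ⁻¹-tilting module: `M` is a τ⁻¹-tilting module over `Λ/(e)`
for some idempotent `e`. -/
def IsSuppTauInvTilting (M : Type u) [AddCommGroup M] [Module R M] [Module K M] : Prop :=
  ∃ e : R, IsIdempotentElem e ∧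
    ∃ (S : Type u) (_ : Ring S) (_ : Algebra K S) (φ : R →+* S),
      (∀ k : K, φ (algebraMap K R k) = algebraMap K S k) ∧
      IsQuotientByIdem R e S φ ∧
      ∃ _ : Module S M, (∀ (r : R) (m : M), φ r • m = r • m) ∧
        ∃ _ : IsScalarTower K S M, IsTauInvTilting S K M

end Support

section Torsion

variable (R : Type u) [Ring R]

/-- A class of modules is closed under isomorphism. -/
def RespectsIso (T : ModuleCat.{u} R → Prop) : Prop :=
  ∀ X Y : ModuleCat.{u} R, Nonempty (X ≃ₗ[R] Y) → T X → T Y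

/-- `(T, F)` is a torsion pair in the category of finitely generated `R`-modules. -/
def IsTorsionPair (T F : ModuleCat.{u} R → Prop) : Prop :=
  RespectsIso R T ∧ RespectsIso R F ∧
  (∀ X, T X → Module.Finite R X) ∧ (∀ X, F X → Module.Finite R X) ∧
  (∀ X Y : ModuleCat.{u} R, T X → F Y → ∀ f : X →ₗ[R] Y, f = 0) ∧
  (∀ X : ModuleCat.{u} R, Module.Finite R X →
    ∃ t : Submodule R X, T (ModuleCat.of R t) ∧ F (ModuleCat.of R (X ⧸ t)))

/-- `T` is covariantly finite: every finitely generated module admits a left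
`T`-approximation. -/
def CovariantlyFinite (T : ModuleCat.{u} R → Prop) : Prop :=
  ∀ X : ModuleCat.{u} R, Module.Finite R X →
    ∃ (M : ModuleCat.{u} R) (f : X →ₗ[R] M), T M ∧
      ∀ (M' : ModuleCat.{u} R) (g : X →ₗ[R] M'), T M' → ∃ h : M →ₗ[R] M', h.comp f = g

/-- `T` is contravariantly finite: every finitely generated module admits a right
`T`-approximation. -/
def ContravariantlyFinite (T : ModuleCat.{u} R → Prop) : Prop :=
  ∀ X : ModuleCat.{u} R, Module.Finite R X →
    ∃ (M : ModuleCat.{u} R) (f : M →ₗ[R] X), T M ∧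
      ∀ (M' : ModuleCat.{u} R) (g : M' →ₗ[R] X), T M' → ∃ h : M' →ₗ[R] M, f.comp h = g

/-- A functorially finite class. -/
def FunctoriallyFinite (T : ModuleCat.{u} R → Prop) : Prop :=
  CovariantlyFinite R T ∧ ContravariantlyFinite R T

/-- `G` is the basic Ext-projective generator of the torsion class `T`:
`G ∈ T` is basic, Ext-projective in `T`, `T = Fac G`, and every Ext-projective
module in `T` lies in `add G`. -/
def IsBasicExtProjGen (T : ModuleCat.{u} R → Prop) (G : ModuleCat.{u} R) : Prop :=
  T G ∧ IsBasic R G ∧ (∀ X : ModuleCat.{u} R, T X → Ext1Vanishes R G X) ∧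
  (∀ X : ModuleCat.{u} R, T X ↔ (Module.Finite R X ∧ FacOf R G X)) ∧
  (∀ X : ModuleCat.{u} R, T X → (∀ Y : ModuleCat.{u} R, T Y → Ext1Vanishes R X Y) →
    InAdd R G X)

/-- `C` is the basic Ext-injective cogenerator of the torsion-free class `F`:
`C ∈ F` is basic, Ext-injective in `F`, `F = Sub C`, and every Ext-injective
module in `F` lies in `add C`. -/
def IsBasicExtInjCogen (F : ModuleCat.{u} R → Prop) (C : ModuleCat.{u} R) : Prop :=
  F C ∧ IsBasic R C ∧ (∀ X : ModuleCat.{u} R, F X → Ext1Vanishes R X C) ∧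
  (∀ X : ModuleCat.{u} R, F X ↔ (Module.Finite R X ∧ SubOf R C X)) ∧
  (∀ X : ModuleCat.{u} R, F X → (∀ Y : ModuleCat.{u} R, F Y → Ext1Vanishes R Y X) →
    InAdd R C X)

variable (K : Type u) [Field K] [Algebra K R]

/-- A (functorially finite) Gorenstein torsion pair: the basic Ext-projective
generator of `T` is Gorenstein projective. -/
def IsGorensteinTP (T F : ModuleCat.{u} R → Prop) : Prop :=
  IsTorsionPair R T F ∧ FunctoriallyFinite R T ∧
    ∀ G : ModuleCat.{u} R, IsBasicExtProjGen R T G → IsGP R G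

/-- A trivial torsion pair: the basic Ext-projective generator of `T` is projective. -/
def IsTrivialTP (T F : ModuleCat.{u} R → Prop) : Prop :=
  IsTorsionPair R T F ∧ FunctoriallyFinite R T ∧
    ∀ G : ModuleCat.{u} R, IsBasicExtProjGen R T G → Module.Projective R G

end Torsion

section Misc

variable (R : Type u) [Ring R] (K : Type u) [Field K] [Algebra K R]

/-- A projective cover `π : P → M`. -/
structure ProjCover (M : Type u) [AddCommGroup M] [Module R M] : Type (u + 1) where
  P : Type u
  [acg : AddCommGroup P]
  [mod : Module R P]
  fin : Module.Finite R P
  proj : Module.Projective R P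
  π : P →ₗ[R] M
  surj : Function.Surjective π
  min : IsSuperfluous R (LinearMap.ker π)

attribute [instance] ProjCover.acg ProjCover.mod

/-- The canonical evaluation map `M → M** = Hom_{Rᵐᵒᵖ}(Hom_R(M, R), Rᵐᵒᵖ)`. -/
def bidualEval (M : Type u) [AddCommGroup M] [Module R M] (m : M) :
    (M →ₗ[R] R) →ₗ[Rᵐᵒᵖ] Rᵐᵒᵖ where
  toFun f := op (f m)
  map_add' f g := by simp
  map_smul' s f := rfl

/-- `R` is CM-τ-tilting finite: up to isomorphism there are only finitely many
indecomposable Gorenstein projective τ-rigid modules. -/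
def CMTauTiltingFinite : Prop :=
  ∃ (n : ℕ) (V : Fin n → ModuleCat.{u} R),
    ∀ (M : Type u) [AddCommGroup M] [Module R M], Module.Finite R M →
      IsIndec R M → IsGP R M → IsTauRigid R K M → ∃ i, Nonempty (M ≃ₗ[R] V i)

/-- `R` is CM-finite: up to isomorphism there are only finitely many
indecomposable Gorenstein projective modules. -/
def CMFinite : Prop :=
  ∃ (n : ℕ) (V : Fin n → ModuleCat.{u} R),
    ∀ (M : Type u) [AddCommGroup M] [Module R M], Module.Finite R M →
      IsIndec R M → IsGP R M → ∃ i, Nonempty (M ≃ₗ[R] V i)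

/-- `T` is the Bongartz completion of the τ-rigid module `M`: the basic
Ext-projective generator of `⊥(τM)`, with `⊥(τM) = Fac T`. -/
def IsBongartzCompletion (M : Type u) [AddCommGroup M] [Module R M]
    (T : Type u) [AddCommGroup T] [Module R T] : Prop :=
  Module.Finite R T ∧ IsBasic R T ∧ InPerpTau R K M T ∧
  (∀ (X : Type u) [AddCommGroup X] [Module R X], Module.Finite R X →
    InPerpTau R K M X → Ext1Vanishes R T X) ∧
  (∀ (X : Type u) [AddCommGroup X] [Module R X], Module.Finite R X →
    (InPerpTau R K M X ↔ FacOf R T X))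

end Misc

/-- `P` is a finitely generated projective module. -/
def FGP (R : Type u) [Ring R] (P : Type u) [AddCommGroup P] [Module R P] : Prop :=
  Module.Finite R P ∧ Module.Projective R P

section Basics

variable {R : Type u} [Ring R]
variable {M N P P' X Y : Type u} [AddCommGroup M] [Module R M] [AddCommGroup N] [Module R N]
  [AddCommGroup P] [Module R P] [AddCommGroup P'] [Module R P']
  [AddCommGroup X] [Module R X] [AddCommGroup Y] [Module R Y]

/-- A linear map killing the kernel of a surjection factors through it. -/
lemma exists_factor (f : X →ₗ[R] Y) (hf : Surjective f) (g : X →ₗ[R] M)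
    (h : ∀ x, f x = 0 → g x = 0) : ∃ k : Y →ₗ[R] M, ∀ x, k (f x) = g x := by
  have hk : ∀ y, ∃ m, ∀ x, f x = y → g x = m := fun y => by
    obtain ⟨x, rfl⟩ := hf y
    refine ⟨g x, fun x' hx' => sub_eq_zero.1 ?_⟩
    rw [← map_sub]
    exact h _ (by rw [map_sub, hx', sub_self])
  choose k hk using hk
  have hk' : ∀ x, k (f x) = g x := fun x => (hk _ x rfl).symm
  refine ⟨{ toFun := k, map_add' := fun a b => ?_, map_smul' := fun r a => ?_ }, hk'⟩
  · obtain ⟨x, rfl⟩ := hf a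
    obtain ⟨y, rfl⟩ := hf b
    rw [← map_add, hk', hk', hk', map_add]
  · obtain ⟨x, rfl⟩ := hf a
    rw [← map_smul, hk', hk', map_smul]; rfl

/-- A linear map whose values lie in the image of an injection factors through it. -/
lemma exists_cofactor (i : X →ₗ[R] Y) (hi : Injective i) (g : M →ₗ[R] Y)
    (h : ∀ m, ∃ x, i x = g m) : ∃ k : M →ₗ[R] X, ∀ m, i (k m) = g m := by
  choose k hk using h
  exact ⟨{ toFun := k
           map_add' := fun a b => hi (by rw [map_add, hk, hk, hk, map_add])
           map_smul' := fun r a => hi (by simp [hk]) }, hk⟩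

lemma exists_lift (hP : Module.Projective R P) (f : X →ₗ[R] Y) (hf : Surjective f)
    (g : P →ₗ[R] Y) : ∃ k : P →ₗ[R] X, ∀ p, f (k p) = g p := by
  obtain ⟨k, hk⟩ := Module.projective_lifting_property f g hf
  exact ⟨k, fun p => by rw [← hk]; rfl⟩

lemma FGP.prod (h : FGP R P) (h' : FGP R P') : FGP R (P × P') := by
  obtain ⟨h1, h2⟩ := h
  obtain ⟨h3, h4⟩ := h'
  exact ⟨inferInstance, inferInstance⟩

lemma FGP.of_retract (h : FGP R P) (i : X →ₗ[R] P) (p : P →ₗ[R] X) (hpi : ∀ x, p (i x) = x) :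
    FGP R X := by
  obtain ⟨h1, h2⟩ := h
  exact ⟨Module.Finite.of_surjective p (fun x => ⟨i x, hpi x⟩),
    Module.Projective.of_split i p (LinearMap.ext hpi)⟩

lemma FGP.of_equiv (h : FGP R P) (e : P ≃ₗ[R] X) : FGP R X :=
  h.of_retract e.symm.toLinearMap e.toLinearMap (by simp)

lemma FGP.of_subsingleton [Subsingleton X] : FGP R X :=
  ⟨inferInstance, Module.Projective.of_split (M := R) 0 0 (Subsingleton.elim _ _)⟩

lemma FGP.ring : FGP R R := ⟨inferInstance, inferInstance⟩

variable {L : Submodule R P}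

lemma IsSuperfluous.mono {L' : Submodule R P} (h : IsSuperfluous R L) (hl : L' ≤ L) :
    IsSuperfluous R L' := fun N hN =>
  h N (top_le_iff.1 (hN ▸ sup_le_sup_right hl N))

lemma IsSuperfluous.sup {L' : Submodule R P} (h : IsSuperfluous R L) (h' : IsSuperfluous R L') :
    IsSuperfluous R (L ⊔ L') := fun N hN =>
  h' N (h _ (by rw [← sup_assoc]; exact hN))

lemma IsSuperfluous.map (h : IsSuperfluous R L) (f : P →ₗ[R] X) :
    IsSuperfluous R (L.map f) := by
  intro N hN
  have h1 : L ⊔ N.comap f = ⊤ := by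
    rw [eq_top_iff]
    intro x _
    have : f x ∈ L.map f ⊔ N := by rw [hN]; trivial
    obtain ⟨y, hy, n, hn, e⟩ := Submodule.mem_sup.1 this
    obtain ⟨l, hl, rfl⟩ := hy
    refine Submodule.mem_sup.2 ⟨l, hl, x - l, ?_, by abel⟩
    rw [Submodule.mem_comap, map_sub, ← e]
    simpa using hn
  have h2 := h _ h1
  have h3 : L.map f ≤ N := by
    rintro _ ⟨l, hl, rfl⟩
    have : l ∈ N.comap f := by rw [h2]; trivial
    exact this
  rwa [sup_eq_right.2 h3] at hN

lemma isSuperfluous_bot : IsSuperfluous R (⊥ : Submodule R P) := fun N hN => by simpa using hN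

lemma IsSuperfluous.prod {L' : Submodule R P'} (h : IsSuperfluous R L)
    (h' : IsSuperfluous R L') : IsSuperfluous R (L.prod L') := by
  refine ((h.map (LinearMap.inl R P P')).sup (h'.map (LinearMap.inr R P P'))).mono ?_
  rintro ⟨x, y⟩ ⟨hx, hy⟩
  exact Submodule.mem_sup.2 ⟨(x, 0), ⟨x, hx, rfl⟩, (0, y), ⟨y, hy, rfl⟩, by simp⟩

/-- A map between projectives that is surjective up to a superfluous submodule and whose kernel
is superfluous is bijective. -/
lemma bijective_of_superfluous (hP' : Module.Projective R P') (f : P →ₗ[R] P')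
    {L' : Submodule R P'} (hL' : IsSuperfluous R L') (h : ∀ y, ∃ x, y - f x ∈ L')
    (hf : IsSuperfluous R (LinearMap.ker f)) : Bijective f := by
  have hs : Surjective f := by
    rw [← LinearMap.range_eq_top]
    refine hL' _ (eq_top_iff.2 fun y _ => ?_)
    obtain ⟨x, hx⟩ := h y
    exact Submodule.mem_sup.2 ⟨_, hx, f x, ⟨x, rfl⟩, by abel⟩
  obtain ⟨s, hs'⟩ := exists_lift hP' f hs LinearMap.id
  refine ⟨?_, hs⟩
  have hr : LinearMap.range s = ⊤ := by
    refine hf _ (eq_top_iff.2 fun x _ => ?_)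
    refine Submodule.mem_sup.2 ⟨x - s (f x), ?_, s (f x), ⟨_, rfl⟩, by abel⟩
    simp [hs']
  rw [← LinearMap.ker_eq_bot, LinearMap.ker_eq_bot']
  intro x hx
  have : x ∈ LinearMap.range s := by rw [hr]; trivial
  obtain ⟨y, rfl⟩ := this
  rw [hs'] at hx
  simp only [LinearMap.id_apply] at hx
  simp [hx]

/-- A submodule of a projective module is superfluous as soon as all endomorphisms with
values in it are nilpotent. -/
lemma isSuperfluous_of_nilpotent (hP : Module.Projective R P)
    (h : ∀ φ : P →ₗ[R] P, (∀ x, φ x ∈ L) → ∃ n : ℕ, ∀ x, (φ ^ n) x = 0) :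
    IsSuperfluous R L := by
  intro N hN
  have hs : Surjective (N.mkQ.comp L.subtype) := by
    intro y
    obtain ⟨x, rfl⟩ := N.mkQ_surjective y
    have : x ∈ L ⊔ N := by rw [hN]; trivial
    obtain ⟨l, hl, n, hn, rfl⟩ := Submodule.mem_sup.1 this
    refine ⟨⟨l, hl⟩, ?_⟩
    simp [(Submodule.Quotient.mk_eq_zero N).2 hn]
  obtain ⟨k, hk⟩ := exists_lift hP _ hs N.mkQ
  obtain ⟨n, hn⟩ := h (L.subtype.comp k) (fun x => (k x).2)
  have key : ∀ (n : ℕ) (x : P), N.mkQ (((L.subtype.comp k) ^ n) x) = N.mkQ x := by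
    intro n
    induction n with
    | zero => simp
    | succ n ih => intro x; rw [pow_succ, Module.End.mul_apply, ih]; exact hk x
  rw [eq_top_iff]
  intro x _
  have := key n x
  rw [hn, map_zero] at this
  simpa using this.symm

/-- If `1 = a + b` with `b` nilpotent, then `a` is injective. -/
lemma injective_of_add_nilpotent (a b : M →ₗ[R] M) (h : ∀ x, a x + b x = x)
    (hb : ∃ n : ℕ, ∀ x, (b ^ n) x = 0) : Injective a := by
  rw [← LinearMap.ker_eq_bot, LinearMap.ker_eq_bot']
  intro x hx
  have h1 : b x = x := by have := h x; rwa [hx, zero_add] at this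
  obtain ⟨n, hn⟩ := hb
  have : ∀ n : ℕ, (b ^ n) x = x := by
    intro n
    induction n with
    | zero => simp
    | succ n ih => rw [pow_succ, Module.End.mul_apply, h1, ih]
  rw [← this n, hn]

variable [IsArtinianRing R]

lemma exists_fitting (hM : Module.Finite R M) (f : M →ₗ[R] M) :
    ∃ n : ℕ, 0 < n ∧ IsCompl (LinearMap.ker (f ^ n)) (LinearMap.range (f ^ n)) := by
  obtain ⟨n, hn⟩ := (LinearMap.eventually_isCompl_ker_pow_range_pow f).exists_forall_of_atTop
  exact ⟨n + 1, n.succ_pos, hn _ (by omega)⟩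

lemma nilpotent_of_isSuperfluous (hP : Module.Finite R P) (hL : IsSuperfluous R L)
    (φ : P →ₗ[R] P) (h : ∀ x, φ x ∈ L) : ∃ n : ℕ, ∀ x, (φ ^ n) x = 0 := by
  obtain ⟨n, hn, hc⟩ := exists_fitting hP φ
  obtain ⟨m, rfl⟩ : ∃ m, n = m + 1 := ⟨n - 1, by omega⟩
  refine ⟨m + 1, fun x => ?_⟩
  have h1 : LinearMap.range (φ ^ (m + 1)) ≤ L := by
    rintro _ ⟨x, rfl⟩
    rw [pow_succ', Module.End.mul_apply]; exact h _
  have := hL.mono h1 _ (by rw [sup_comm]; exact hc.sup_eq_top)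
  have : x ∈ LinearMap.ker (φ ^ (m + 1)) := by rw [this]; trivial
  exact this

/-- Mutual retracts of finite length are isomorphic. -/
lemma nonempty_equiv_of_injective (hM : Module.Finite R M) (f : M →ₗ[R] N) (hf : Injective f)
    (g : N →ₗ[R] M) (hg : Injective g) : Nonempty (M ≃ₗ[R] N) := by
  have h := IsArtinian.bijective_of_injective_endomorphism (g.comp f) (by
    rw [LinearMap.coe_comp]; exact hg.comp hf)
  have hgs : Surjective g := fun x => by
    obtain ⟨y, hy⟩ := h.2 x
    exact ⟨f y, hy⟩
  exact ⟨(LinearEquiv.ofBijective g ⟨hg, hgs⟩).symm⟩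

end Basics

section Basics2

variable {R : Type u} [Ring R]
variable {M N P P' X Y : Type u} [AddCommGroup M] [Module R M] [AddCommGroup N] [Module R N]
  [AddCommGroup P] [Module R P] [AddCommGroup P'] [Module R P']
  [AddCommGroup X] [Module R X] [AddCommGroup Y] [Module R Y]

lemma FGP.dual_basis (h : FGP R P) : ∃ (n : ℕ) (α : Fin n → (P →ₗ[R] R)) (v : Fin n → P),
    ∀ p, ∑ i, α i p • v i = p := by
  obtain ⟨h1, h2⟩ := h
  obtain ⟨n, f, hf⟩ := Module.Finite.exists_fin' R P
  obtain ⟨s, hs⟩ := exists_lift h2 f hf LinearMap.id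
  refine ⟨n, fun i => (LinearMap.proj i).comp s, fun i => f (Pi.single i 1), fun p => ?_⟩
  have h3 : s p = ∑ i, s p i • (Pi.single i 1 : Fin n → R) := by
    ext j; simp [Finset.sum_apply, Pi.single_apply]
  have h4 := hs p
  rw [h3, map_sum] at h4
  simpa using h4

lemma FGP.of_basis {n : ℕ} (α : Fin n → (P →ₗ[R] R)) (v : Fin n → P)
    (h : ∀ p, ∑ i, α i p • v i = p) : FGP R P := by
  have h1 : FGP R (Fin n → R) := ⟨inferInstance, inferInstance⟩
  refine h1.of_retract (LinearMap.pi α) (Fintype.linearCombination R v) (fun x => ?_)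
  simpa [Fintype.linearCombination_apply] using h x

lemma MinPres.fgp₁ (pr : MinPres R M) : FGP R pr.P₁ := ⟨pr.fin₁, pr.proj₁⟩
lemma MinPres.fgp₀ (pr : MinPres R M) : FGP R pr.P₀ := ⟨pr.fin₀, pr.proj₀⟩

lemma noProjSummand_of_nilpotent (hM : Module.Finite R M)
    (h : ∀ (P : Type u) [AddCommGroup P] [Module R P], FGP R P → ∀ (a : M →ₗ[R] P)
      (b : P →ₗ[R] M), ∃ n : ℕ, ∀ x, ((b.comp a) ^ n) x = 0) : NoProjSummand R M := by
  intro N₁ N₂ hc hp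
  let π := N₁.projectionOnto N₂ hc
  have hπ : ∀ x : N₁, π x = x := fun x => Submodule.projectionOnto_apply_left hc x
  have hfin : FGP R N₁ := ⟨Module.Finite.of_surjective π (fun x => ⟨x, hπ x⟩), hp⟩
  obtain ⟨n, hn⟩ := h N₁ hfin π N₁.subtype
  rw [eq_bot_iff]
  intro x hx
  have h1 : (N₁.subtype.comp π) x = x := congrArg Subtype.val (hπ ⟨x, hx⟩)
  have : ∀ n : ℕ, ((N₁.subtype.comp π) ^ n) x = x := by
    intro n
    induction n with
    | zero => simp
    | succ n ih => rw [pow_succ, Module.End.mul_apply, h1, ih]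
  rw [← this n, hn]; rfl

variable [IsArtinianRing R]

lemma NoProjSummand.nilpotent (hM : Module.Finite R M) (h : NoProjSummand R M) (hP : FGP R P)
    (a : M →ₗ[R] P) (b : P →ₗ[R] M) : ∃ n : ℕ, ∀ x, ((b.comp a) ^ n) x = 0 := by
  obtain ⟨n, hn, hc⟩ := exists_fitting hM (b.comp a)
  set φ := b.comp a with hφ
  obtain ⟨m, rfl⟩ : ∃ m, n = m + 1 := ⟨n - 1, by omega⟩
  refine ⟨m + 1, ?_⟩
  set I := LinearMap.range (φ ^ (m + 1)) with hI
  have hker : ∀ x ∈ I, (φ ^ (m + 1)) x = 0 → x = 0 := fun x hx h0 =>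
    (Submodule.disjoint_def.1 hc.disjoint) x h0 hx
  let c : I →ₗ[R] P := (a.comp (φ ^ m)).comp I.subtype
  let q : P →ₗ[R] I := (φ ^ (m + 1)).rangeRestrict.comp b
  have hqc : ∀ x : I, ((q (c x) : I) : M) = (φ ^ (m + 1)) ((φ ^ (m + 1)) x) := by
    intro x
    change (φ ^ (m + 1)) (b (a ((φ ^ m) x))) = _
    rw [pow_succ' φ m, Module.End.mul_apply, Module.End.mul_apply]; rfl
  have hinj : Injective (q.comp c) := by
    rw [← LinearMap.ker_eq_bot, LinearMap.ker_eq_bot']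
    intro x hx
    have h1 : ((q (c x) : I) : M) = 0 := by
      rw [← LinearMap.comp_apply, hx]; rfl
    rw [hqc] at h1
    exact Subtype.ext (hker _ x.2 (hker _ ⟨_, rfl⟩ h1))
  have hbij := IsArtinian.bijective_of_injective_endomorphism _ hinj
  let e := LinearEquiv.ofBijective _ hbij
  have hFGP : FGP R I := hP.of_retract c (e.symm.toLinearMap.comp q) (fun x => by
    change e.symm (q (c x)) = x
    rw [LinearEquiv.symm_apply_eq]; rfl)
  have hbot : I = ⊥ := h _ _ hc.symm hFGP.2
  intro x
  have : (φ ^ (m + 1)) x ∈ I := ⟨x, rfl⟩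
  rw [hbot] at this
  exact this

/-- Existence of projective covers. -/
lemma exists_cover (hM : Module.Finite R M) : ∃ (P : Type u) (_ : AddCommGroup P)
    (_ : Module R P) (π : P →ₗ[R] M), FGP R P ∧ Surjective π ∧
      IsSuperfluous R (LinearMap.ker π) := by
  obtain ⟨n, f, hf⟩ := Module.Finite.exists_fin' R M
  let s : Set (Submodule R (Fin n → R)) := {N | FGP R N ∧ ∀ m, ∃ x ∈ N, f x = m}
  have hs : s.Nonempty := ⟨⊤, (FGP.of_equiv (P := Fin n → R) ⟨inferInstance, inferInstance⟩
    Submodule.topEquiv.symm), fun m => by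
      obtain ⟨x, hx⟩ := hf m; exact ⟨x, trivial, hx⟩⟩
  obtain ⟨N, ⟨hN1, hN2⟩, hmin⟩ := IsArtinian.set_has_minimal s hs
  refine ⟨N, inferInstance, inferInstance, f.comp N.subtype, hN1, fun m => ?_, ?_⟩
  · obtain ⟨x, hx, rfl⟩ := hN2 m
    exact ⟨⟨x, hx⟩, rfl⟩
  refine isSuperfluous_of_nilpotent hN1.2 (fun φ hφ => ?_)
  obtain ⟨k, hk, hc⟩ := exists_fitting hN1.1 φ
  obtain ⟨k, rfl⟩ : ∃ m, k = m + 1 := ⟨k - 1, by omega⟩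
  refine ⟨k + 1, fun x => ?_⟩
  set A := LinearMap.ker (φ ^ (k + 1))
  have hA : FGP R A := hN1.of_retract A.subtype (A.projectionOnto _ hc)
    (fun x => Submodule.projectionOnto_apply_left hc x)
  have hA' : FGP R (A.map N.subtype) := hA.of_equiv
    (Submodule.equivMapOfInjective N.subtype N.injective_subtype A)
  have hmem : A.map N.subtype ∈ s := by
    refine ⟨hA', fun m => ?_⟩
    obtain ⟨x, hx, rfl⟩ := hN2 m
    have : (⟨x, hx⟩ : N) ∈ A ⊔ LinearMap.range (φ ^ (k + 1)) := by rw [hc.sup_eq_top]; trivial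
    obtain ⟨a, ha, _, ⟨y, rfl⟩, e⟩ := Submodule.mem_sup.1 this
    refine ⟨a, ⟨a, ha, rfl⟩, ?_⟩
    have h0 : f (((φ ^ (k + 1)) y : N) : Fin n → R) = 0 := by
      rw [pow_succ', Module.End.mul_apply]
      exact hφ _
    have h1 := congrArg (fun z : N => f z) e
    simp only [Submodule.coe_add, map_add, h0, add_zero] at h1
    exact h1
  have hle : A.map N.subtype ≤ N := by rintro _ ⟨x, _, rfl⟩; exact x.2
  have heq : A.map N.subtype = N := by
    by_contra hne
    exact hmin _ hmem (lt_of_le_of_ne hle hne)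
  have : (x : Fin n → R) ∈ A.map N.subtype := by rw [heq]; exact x.2
  obtain ⟨y, hy, e⟩ := this
  have : y = x := Subtype.ext e
  rw [← this]; exact hy

lemma nonempty_minPres (hM : Module.Finite R M) : Nonempty (MinPres R M) := by
  obtain ⟨P₀, _, _, p, h0, hp, hs⟩ := exists_cover hM
  have := h0.1
  obtain ⟨P₁, _, _, q, h1, hq, hs'⟩ :=
    exists_cover (R := R) (M := LinearMap.ker p) inferInstance
  exact ⟨{ P₁ := P₁, P₀ := P₀, fin₁ := h1.1, fin₀ := h0.1, proj₁ := h1.2, proj₀ := h0.2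
           d := (LinearMap.ker p).subtype.comp q, p := p, surj := hp
           exact := fun x => ⟨fun hx => by
              obtain ⟨y, hy⟩ := hq ⟨x, hx⟩
              exact ⟨y, congrArg Subtype.val hy⟩, fun ⟨y, hy⟩ => by rw [← hy]; exact (q y).2⟩
           min₀ := hs
           min₁ := hs'.mono (fun x hx => Subtype.ext hx) }⟩

end Basics2

/-- An additive bijection between two rings reversing products. -/
structure AntiIso (R S : Type u) [Ring R] [Ring S] where
  e : R ≃+ S
  map_mul : ∀ a b, e (a * b) = e b * e a

namespace AntiIso
variable {R S : Type u} [Ring R] [Ring S] (σ : AntiIso R S)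

/-- The inverse anti-isomorphism. -/
def symm : AntiIso S R where
  e := σ.e.symm
  map_mul a b := by
    apply σ.e.injective
    rw [σ.map_mul]; simp

lemma map_one : σ.e 1 = 1 := by
  have h : ∀ s, σ.e 1 * s = s := fun s => by
    obtain ⟨x, rfl⟩ := σ.e.surjective s
    rw [← σ.map_mul, mul_one]
  rw [← h 1, mul_one]

lemma symm_map_mul (a b : S) : σ.e.symm (a * b) = σ.e.symm b * σ.e.symm a := σ.symm.map_mul a b

lemma symm_map_one : σ.e.symm 1 = 1 := σ.symm.map_one

end AntiIso

/-- The canonical anti-isomorphism from a ring to its opposite. -/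
def opAnti (R : Type u) [Ring R] : AntiIso R Rᵐᵒᵖ where
  e := opAddEquiv
  map_mul _ _ := rfl

section
variable {R S : Type u} [Ring R] [Ring S] (σ : AntiIso R S)

/-- A perfect pairing between a projective `R`-module and a projective `S`-module. -/
structure DualPair (P Q : Type u) [AddCommGroup P] [Module R P] [AddCommGroup Q] [Module S Q] where
  b : P → Q → R
  add_left : ∀ p p' q, b (p + p') q = b p q + b p' q
  add_right : ∀ p q q', b p (q + q') = b p q + b p q'
  smul_left : ∀ r p q, b (r • p) q = r * b p q
  smul_right : ∀ s p q, b p (s • q) = b p q * σ.e.symm s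
  left : ∀ f : P →ₗ[R] R, ∃ q, ∀ p, b p q = f p
  left_inj : ∀ q, (∀ p, b p q = 0) → q = 0
  right : ∀ g : Q →ₗ[S] S, ∃ p, ∀ q, σ.e (b p q) = g q
  right_inj : ∀ p, (∀ q, b p q = 0) → p = 0
  fgpP : FGP R P
  fgpQ : FGP S Q

namespace DualPair
variable {σ}
variable {P Q P' Q' P'' Q'' : Type u} [AddCommGroup P] [Module R P] [AddCommGroup Q] [Module S Q]
  [AddCommGroup P'] [Module R P'] [AddCommGroup Q'] [Module S Q']
  [AddCommGroup P''] [Module R P''] [AddCommGroup Q''] [Module S Q'']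

/-- The pairing with the two sides exchanged. -/
def swap (D : DualPair σ P Q) : DualPair σ.symm Q P where
  b q p := σ.e (D.b p q)
  add_left q q' p := by rw [D.add_right, map_add]
  add_right q p p' := by rw [D.add_left, map_add]
  smul_left s q p := by rw [D.smul_right, σ.map_mul]; simp
  smul_right r q p := by rw [D.smul_left, σ.map_mul]; rfl
  left := D.right
  left_inj p h := D.right_inj p (fun q => σ.e.injective (by rw [h, map_zero]))
  right f := by
    obtain ⟨q, hq⟩ := D.left f
    exact ⟨q, fun p => by rw [← hq]; exact σ.e.symm_apply_apply _⟩
  right_inj q h := D.left_inj q (fun p => σ.e.injective (by rw [h, map_zero]))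
  fgpP := D.fgpQ
  fgpQ := D.fgpP

/-- Pairing with a fixed element on the right. -/
def mapL (D : DualPair σ P Q) (q : Q) : P →ₗ[R] R where
  toFun p := D.b p q
  map_add' p p' := D.add_left p p' q
  map_smul' r p := D.smul_left r p q

@[simp]
lemma mapL_apply (D : DualPair σ P Q) (q : Q) (p : P) : D.mapL q p = D.b p q := rfl

lemma zero_left (D : DualPair σ P Q) (q : Q) : D.b 0 q = 0 := (D.mapL q).map_zero
lemma sub_left (D : DualPair σ P Q) (p p' : P) (q : Q) : D.b (p - p') q = D.b p q - D.b p' q :=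
  (D.mapL q).map_sub p p'
lemma sub_right (D : DualPair σ P Q) (p : P) (q q' : Q) :
    D.b p (q - q') = D.b p q - D.b p q' := by
  have h := D.add_right p (q - q') q'
  rw [sub_add_cancel] at h
  rw [h, add_sub_cancel_right]
lemma zero_right (D : DualPair σ P Q) (p : P) : D.b p 0 = 0 := by
  have := D.sub_right p 0 0
  simpa using this

lemma ext_right (D : DualPair σ P Q) {q q' : Q} (h : ∀ p, D.b p q = D.b p q') : q = q' :=
  sub_eq_zero.1 (D.left_inj _ fun p => by rw [sub_right, h, sub_self])

/-- Two maps are adjoint with respect to given pairings. -/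
def Adj (D : DualPair σ P Q) (D' : DualPair σ P' Q') (f : P →ₗ[R] P') (g : Q' →ₗ[S] Q) : Prop :=
  ∀ p q, D.b p (g q) = D'.b (f p) q

variable {D : DualPair σ P Q} {D' : DualPair σ P' Q'} {D'' : DualPair σ P'' Q''}

lemma Adj.swap {f : P →ₗ[R] P'} {g : Q' →ₗ[S] Q} (h : Adj D D' f g) :
    Adj D'.swap D.swap g f := fun q p => congrArg σ.e (h p q).symm

lemma exists_adj (D : DualPair σ P Q) (D' : DualPair σ P' Q') (f : P →ₗ[R] P') :
    ∃ g, Adj D D' f g := by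
  choose g hg using fun q => D.left ((D'.mapL q).comp f)
  refine ⟨{ toFun := g, map_add' := fun a b => ?_, map_smul' := fun r a => ?_ }, fun p q => hg q p⟩
  · refine D.ext_right fun p => ?_
    rw [D.add_right, hg, hg, hg]; simp [D'.add_right]
  · refine D.ext_right fun p => ?_
    simp only [RingHom.id_apply]
    rw [D.smul_right, hg, hg]; simp [D'.smul_right]

lemma exists_adj' (D : DualPair σ P Q) (D' : DualPair σ P' Q') (g : Q' →ₗ[S] Q) :
    ∃ f, Adj D D' f g := by
  obtain ⟨f, hf⟩ := exists_adj D'.swap D.swap g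
  exact ⟨f, fun p q => σ.e.injective (hf q p).symm⟩

lemma Adj.comp {f : P →ₗ[R] P'} {g : Q' →ₗ[S] Q} {f' : P' →ₗ[R] P''} {g' : Q'' →ₗ[S] Q'}
    (h : Adj D D' f g) (h' : Adj D' D'' f' g') : Adj D D'' (f'.comp f) (g.comp g') :=
  fun p q => by
    rw [LinearMap.comp_apply, LinearMap.comp_apply, h, h']

lemma Adj.pow {f : P →ₗ[R] P} {g : Q →ₗ[S] Q} (h : Adj D D f g) (n : ℕ) :
    Adj D D (f ^ n) (g ^ n) := by
  induction n with
  | zero => intro p q; rfl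
  | succ n ih => rw [pow_succ, pow_succ']; exact h.comp ih

lemma Adj.eq_zero {f : P →ₗ[R] P'} {g : Q' →ₗ[S] Q} (h : Adj D D' f g) (hf : ∀ p, f p = 0)
    (q : Q') : g q = 0 :=
  D.left_inj _ fun p => by rw [h, hf, D'.zero_left]

lemma Adj.eq_zero' {f : P →ₗ[R] P'} {g : Q' →ₗ[S] Q} (h : Adj D D' f g) (hg : ∀ p, g p = 0)
    (p : P) : f p = 0 :=
  D'.right_inj _ fun q => by rw [← h, hg, D.zero_right]

lemma Adj.unique {f : P →ₗ[R] P'} {g g' : Q' →ₗ[S] Q} (h : Adj D D' f g) (h' : Adj D D' f g')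
    (q : Q') : g q = g' q :=
  D.ext_right fun p => by rw [h, h']

/-- Transport of a pairing along isomorphisms. -/
def congr (D : DualPair σ P Q) (e : P ≃ₗ[R] P') (e' : Q ≃ₗ[S] Q') : DualPair σ P' Q' where
  b p q := D.b (e.symm p) (e'.symm q)
  add_left p p' q := by rw [map_add, D.add_left]
  add_right q p p' := by rw [map_add, D.add_right]
  smul_left s q p := by rw [map_smul, D.smul_left]
  smul_right r q p := by rw [map_smul, D.smul_right]
  left f := by
    obtain ⟨q, hq⟩ := D.left (f.comp e.toLinearMap)
    exact ⟨e' q, fun p => by rw [e'.symm_apply_apply, hq]; simp⟩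
  left_inj q h := by
    have := D.left_inj (e'.symm q) (fun p => by have := h (e p); rwa [e.symm_apply_apply] at this)
    simpa using this
  right f := by
    obtain ⟨q, hq⟩ := D.right (f.comp e'.toLinearMap)
    exact ⟨e q, fun p => by rw [e.symm_apply_apply, hq]; simp⟩
  right_inj q h := by
    have := D.right_inj (e.symm q) (fun p => by have := h (e' p); rwa [e'.symm_apply_apply] at this)
    simpa using this
  fgpP := D.fgpP.of_equiv e
  fgpQ := D.fgpQ.of_equiv e'

/-- The product of two pairings. -/
def prod (D : DualPair σ P Q) (D' : DualPair σ P' Q') : DualPair σ (P × P') (Q × Q') where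
  b p q := D.b p.1 q.1 + D'.b p.2 q.2
  add_left p p' q := by simp only [Prod.fst_add, Prod.snd_add, D.add_left, D'.add_left]; abel
  add_right q p p' := by simp only [Prod.fst_add, Prod.snd_add, D.add_right, D'.add_right]; abel
  smul_left s q p := by
    simp only [Prod.smul_fst, Prod.smul_snd, D.smul_left, D'.smul_left, mul_add]
  smul_right r q p := by
    simp only [Prod.smul_fst, Prod.smul_snd, D.smul_right, D'.smul_right, add_mul]
  left f := by
    obtain ⟨q, hq⟩ := D.left (f.comp (LinearMap.inl R P P'))
    obtain ⟨q', hq'⟩ := D'.left (f.comp (LinearMap.inr R P P'))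
    refine ⟨(q, q'), fun p => ?_⟩
    rw [hq, hq', LinearMap.comp_apply, LinearMap.comp_apply, ← map_add]
    simp
  left_inj q h := by
    refine Prod.ext (D.left_inj _ fun p => ?_) (D'.left_inj _ fun p => ?_)
    · simpa [D'.zero_left] using h (p, 0)
    · simpa [D.zero_left] using h (0, p)
  right f := by
    obtain ⟨q, hq⟩ := D.right (f.comp (LinearMap.inl S Q Q'))
    obtain ⟨q', hq'⟩ := D'.right (f.comp (LinearMap.inr S Q Q'))
    refine ⟨(q, q'), fun p => ?_⟩
    rw [map_add, hq, hq', LinearMap.comp_apply, LinearMap.comp_apply, ← map_add]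
    simp
  right_inj q h := by
    refine Prod.ext (D.right_inj _ fun p => ?_) (D'.right_inj _ fun p => ?_)
    · simpa [D'.zero_right] using h (p, 0)
    · simpa [D.zero_right] using h (0, p)
  fgpP := D.fgpP.prod D'.fgpP
  fgpQ := D.fgpQ.prod D'.fgpQ

/-- The pairing of zero modules. -/
def ofSubsingleton (σ : AntiIso R S) [Subsingleton P] [Subsingleton Q] : DualPair σ P Q where
  b _ _ := 0
  add_left _ _ _ := by simp
  add_right _ _ _ := by simp
  smul_left _ _ _ := by simp
  smul_right _ _ _ := by simp
  left f := ⟨0, fun p => by rw [Subsingleton.elim p 0, map_zero]⟩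
  left_inj _ _ := Subsingleton.elim _ _
  right f := ⟨0, fun p => by rw [Subsingleton.elim p 0, map_zero, map_zero]⟩
  right_inj _ _ := Subsingleton.elim _ _
  fgpP := FGP.of_subsingleton
  fgpQ := FGP.of_subsingleton

/-- The pairing of the two regular modules. -/
def ring (σ : AntiIso R S) : DualPair σ R S where
  b r s := r * σ.e.symm s
  add_left _ _ _ := by rw [add_mul]
  add_right _ _ _ := by rw [map_add, mul_add]
  smul_left _ _ _ := by rw [smul_eq_mul, mul_assoc]
  smul_right _ _ _ := by rw [smul_eq_mul, σ.symm_map_mul, mul_assoc]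
  left f := ⟨σ.e (f 1), fun p => by
    rw [AddEquiv.symm_apply_apply, ← smul_eq_mul, ← map_smul]; simp⟩
  left_inj s h := by have := h 1; simpa using this
  right f := ⟨σ.e.symm (f 1), fun p => by
    rw [σ.map_mul, AddEquiv.apply_symm_apply, AddEquiv.apply_symm_apply, ← smul_eq_mul,
      ← map_smul]; simp⟩
  right_inj s h := by have := h 1; simpa [σ.symm_map_one] using this
  fgpP := FGP.ring
  fgpQ := FGP.ring

lemma nonempty_equiv (D : DualPair σ P Q) (D' : DualPair σ P' Q') (e : P ≃ₗ[R] P') :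
    Nonempty (Q ≃ₗ[S] Q') := by
  obtain ⟨g, hg⟩ := exists_adj D D' e.toLinearMap
  obtain ⟨g', hg'⟩ := exists_adj D' D e.symm.toLinearMap
  refine ⟨LinearEquiv.ofLinearMap g' g (LinearMap.ext fun q => ?_) (LinearMap.ext fun q => ?_)⟩
  · refine (hg'.comp hg).unique (g' := LinearMap.id) (fun p q => ?_) q
    simp
  · refine (hg.comp hg').unique (g' := LinearMap.id) (fun p q => ?_) q
    simp

end DualPair

/-- The dual `Hom_R(A, R)` regarded as an `S`-module. -/
def Dual (_σ : AntiIso R S) (A : Type u) [AddCommGroup A] [Module R A] : Type u := A →ₗ[R] R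

variable (A : Type u) [AddCommGroup A] [Module R A]

instance : AddCommGroup (Dual σ A) := inferInstanceAs (AddCommGroup (A →ₗ[R] R))

variable {A σ} in
/-- Evaluation of an element of the dual. -/
def Dual.ev (f : Dual σ A) : A →ₗ[R] R := f

variable {A} in
lemma Dual.ext_ev {f g : Dual σ A} (h : ∀ a, f.ev a = g.ev a) : f = g :=
  LinearMap.ext (f := Dual.ev f) (g := Dual.ev g) h

instance : SMul S (Dual σ A) := ⟨fun s f =>
  ({ toFun := fun a => f.ev a * σ.e.symm s
     map_add' := fun a b => by rw [map_add, add_mul]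
     map_smul' := fun r a => by rw [map_smul, smul_eq_mul, mul_assoc]; rfl } : A →ₗ[R] R)⟩

lemma Dual.smul_ev (s : S) (f : Dual σ A) (a : A) : (s • f).ev a = f.ev a * σ.e.symm s := rfl
lemma Dual.add_ev (f g : Dual σ A) (a : A) : (f + g).ev a = f.ev a + g.ev a := rfl
lemma Dual.zero_ev (a : A) : (0 : Dual σ A).ev a = 0 := rfl

instance : Module S (Dual σ A) where
  one_smul f := Dual.ext_ev σ fun a => by rw [Dual.smul_ev, σ.symm_map_one, mul_one]
  mul_smul s t f := Dual.ext_ev σ fun a => by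
    rw [Dual.smul_ev, Dual.smul_ev, Dual.smul_ev, σ.symm_map_mul, mul_assoc]
  smul_zero s := Dual.ext_ev σ fun a => by rw [Dual.smul_ev, Dual.zero_ev, zero_mul]
  smul_add s f g := Dual.ext_ev σ fun a => by
    simp only [Dual.smul_ev, Dual.add_ev, add_mul]
  add_smul s t f := Dual.ext_ev σ fun a => by
    simp only [Dual.smul_ev, Dual.add_ev, map_add, mul_add]
  zero_smul f := Dual.ext_ev σ fun a => by
    rw [Dual.smul_ev, Dual.zero_ev, map_zero, mul_zero]

variable {A σ}

/-- `Dual.ev` at a fixed point, as an additive map. -/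
def Dual.evHom (a : A) : Dual σ A →+ R where
  toFun f := f.ev a
  map_zero' := rfl
  map_add' _ _ := rfl

lemma Dual.sum_ev {ι : Type*} (s : Finset ι) (f : ι → Dual σ A) (a : A) :
    (∑ i ∈ s, f i).ev a = ∑ i ∈ s, (f i).ev a :=
  map_sum (Dual.evHom (σ := σ) a) f s

/-- A finitely generated projective module is in duality with its dual. -/
lemma FGP.exists_dualPair_dual (σ : AntiIso R S) (h : FGP R A) :
    ∃ D : DualPair σ A (Dual σ A), ∀ a f, D.b a f = f.ev a := by
  obtain ⟨n, α', v, hv⟩ := h.dual_basis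
  let α : Fin n → Dual σ A := α'
  have key : ∀ f : Dual σ A, ∑ i, σ.e (f.ev (v i)) • α i = f := by
    intro f
    refine Dual.ext_ev σ fun a => ?_
    rw [Dual.sum_ev]
    simp only [Dual.smul_ev, AddEquiv.symm_apply_apply]
    nth_rewrite 2 [← hv a]
    rw [map_sum]
    simp only [map_smul, smul_eq_mul]
    rfl
  exact ⟨{
    b := fun a f => f.ev a
    add_left := fun a a' f => map_add _ _ _
    add_right := fun _ _ _ => rfl
    smul_left := fun r a f => map_smul _ _ _
    smul_right := fun s a f => rfl
    left := fun f => ⟨f, fun _ => rfl⟩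
    left_inj := fun f hf => Dual.ext_ev σ hf
    right := fun g => ⟨∑ i, σ.e.symm (g (α i)) • v i, fun f => by
      rw [map_sum]
      simp only [map_smul, smul_eq_mul]
      rw [map_sum]
      simp only [σ.map_mul, AddEquiv.apply_symm_apply]
      conv_rhs => rw [← key f, map_sum]
      simp only [map_smul, smul_eq_mul]⟩
    right_inj := fun a ha => by
      rw [← hv a]
      exact Finset.sum_eq_zero fun i _ => by
        rw [show α' i a = 0 from ha (α i), zero_smul]
    fgpP := h
    fgpQ := FGP.of_basis (n := n) (fun i =>
      { toFun := fun f => σ.e (f.ev (v i))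
        map_add' := fun f g => by rw [Dual.add_ev, map_add]
        map_smul' := fun s f => by
          rw [Dual.smul_ev, σ.map_mul, AddEquiv.apply_symm_apply]; rfl }) α key }, fun _ _ => rfl⟩

/-- The standard dual of a projective module as a module over the opposite ring. -/
lemma FGP.exists_dualPair_op (h : FGP R A) :
    ∃ D : DualPair (opAnti R) A (A →ₗ[R] R), ∀ a f, D.b a f = f a := by
  obtain ⟨D, hD⟩ := h.exists_dualPair_dual (opAnti R)
  refine ⟨D.congr (LinearEquiv.refl R A) (LinearEquiv.mk
    { toFun := fun f => Dual.ev f, map_add' := fun _ _ => rfl, map_smul' := fun _ _ => rfl }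
    (fun f => f) (fun _ => rfl) (fun _ => rfl)), fun a f => hD _ _⟩

lemma FGP.exists_dualPair (σ : AntiIso R S) (h : FGP R A) : ∃ (Q : Type u) (_ : AddCommGroup Q)
    (_ : Module S Q), Nonempty (DualPair σ A Q) :=
  let ⟨D, _⟩ := h.exists_dualPair_dual σ
  ⟨_, _, _, ⟨D⟩⟩

lemma FGP.exists_dualPair' (σ : AntiIso R S) {B : Type u} [AddCommGroup B] [Module S B]
    (h : FGP S B) : ∃ (P : Type u) (_ : AddCommGroup P)
    (_ : Module R P), Nonempty (DualPair σ P B) := by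
  obtain ⟨P, _, _, ⟨D⟩⟩ := h.exists_dualPair σ.symm
  exact ⟨P, _, _, ⟨D.swap⟩⟩

end

section
variable {R : Type u} [Ring R] {A A' B B' : Type u} [AddCommGroup A] [Module R A]
  [AddCommGroup A'] [Module R A'] [AddCommGroup B] [Module R B] [AddCommGroup B'] [Module R B']

lemma comp_pow_succ_apply (f : A →ₗ[R] B) (g : B →ₗ[R] A) (n : ℕ) (x : B) :
    ((f.comp g) ^ (n + 1)) x = f (((g.comp f) ^ n) (g x)) := by
  induction n generalizing x with
  | zero => simp
  | succ n ih =>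
    rw [pow_succ, Module.End.mul_apply, ih, pow_succ, Module.End.mul_apply]
    rfl

lemma semiconj_pow_apply (f : A →ₗ[R] A) (g : B →ₗ[R] B) (p : A →ₗ[R] B)
    (h : ∀ x, p (f x) = g (p x)) (n : ℕ) (x : A) : p ((f ^ n) x) = (g ^ n) (p x) := by
  induction n generalizing x with
  | zero => simp
  | succ n ih => rw [pow_succ, pow_succ, Module.End.mul_apply, Module.End.mul_apply, ih, h]

lemma MinPres.finite (pr : MinPres R A) : Module.Finite R A :=
  have := pr.fin₀
  Module.Finite.of_surjective pr.p pr.surj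

lemma MinPres.p_d (pr : MinPres R A) (x : pr.P₁) : pr.p (pr.d x) = 0 :=
  (pr.exact _).2 ⟨x, rfl⟩

/-- Transport of a minimal presentation along an isomorphism. -/
def MinPres.congr (pr : MinPres R A) (e : A ≃ₗ[R] A') : MinPres R A' where
  P₁ := pr.P₁
  P₀ := pr.P₀
  fin₁ := pr.fin₁
  fin₀ := pr.fin₀
  proj₁ := pr.proj₁
  proj₀ := pr.proj₀
  d := pr.d
  p := e.toLinearMap.comp pr.p
  surj := e.surjective.comp pr.surj
  exact x := by
    rw [← pr.exact x]
    simp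
  min₀ := by rw [LinearEquiv.ker_comp]; exact pr.min₀
  min₁ := pr.min₁

/-- The product of two minimal presentations. -/
def MinPres.prod (pr : MinPres R A) (pr' : MinPres R B) : MinPres R (A × B) where
  P₁ := pr.P₁ × pr'.P₁
  P₀ := pr.P₀ × pr'.P₀
  fin₁ := (pr.fgp₁.prod pr'.fgp₁).1
  fin₀ := (pr.fgp₀.prod pr'.fgp₀).1
  proj₁ := (pr.fgp₁.prod pr'.fgp₁).2
  proj₀ := (pr.fgp₀.prod pr'.fgp₀).2
  d := pr.d.prodMap pr'.d
  p := pr.p.prodMap pr'.p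
  surj := pr.surj.prodMap pr'.surj
  exact x := by
    have h1 := pr.exact x.1
    have h2 := pr'.exact x.2
    constructor
    · intro h
      obtain ⟨a, ha⟩ := h1.1 (congrArg Prod.fst h)
      obtain ⟨b, hb⟩ := h2.1 (congrArg Prod.snd h)
      exact ⟨(a, b), Prod.ext ha hb⟩
    · rintro ⟨⟨a, b⟩, rfl⟩
      exact Prod.ext (pr.p_d a) (pr'.p_d b)
  min₀ := by rw [LinearMap.ker_prodMap]; exact pr.min₀.prod pr'.min₀
  min₁ := by rw [LinearMap.ker_prodMap]; exact pr.min₁.prod pr'.min₁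

/-- The minimal presentation of a projective module. -/
def MinPres.ofFGP (h : FGP R A) : MinPres R A where
  P₁ := PUnit
  P₀ := A
  fin₁ := FGP.of_subsingleton.1
  fin₀ := h.1
  proj₁ := FGP.of_subsingleton.2
  proj₀ := h.2
  d := 0
  p := LinearMap.id
  surj := surjective_id
  exact x := by
    constructor
    · rintro rfl
      exact ⟨0, rfl⟩
    · rintro ⟨_, rfl⟩
      rfl
  min₀ := by rw [LinearMap.ker_id]; exact isSuperfluous_bot
  min₁ := fun N _ => eq_top_iff.2 fun x _ => by
    rw [show x = 0 from rfl]; exact N.zero_mem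

lemma MinPres.exists_equiv (pr : MinPres R A) (pr' : MinPres R A') (e : A ≃ₗ[R] A') :
    ∃ (f₀ : pr.P₀ ≃ₗ[R] pr'.P₀) (f₁ : pr.P₁ ≃ₗ[R] pr'.P₁),
      (∀ x, pr'.p (f₀ x) = e (pr.p x)) ∧ ∀ x, pr'.d (f₁ x) = f₀ (pr.d x) := by
  obtain ⟨f₀, h₀⟩ := exists_lift pr.proj₀ pr'.p pr'.surj (e.toLinearMap.comp pr.p)
  have b₀ : Bijective f₀ := by
    refine bijective_of_superfluous pr'.proj₀ f₀ pr'.min₀ (fun y => ?_) (pr.min₀.mono ?_)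
    · obtain ⟨x, hx⟩ := pr.surj (e.symm (pr'.p y))
      refine ⟨x, ?_⟩
      rw [LinearMap.mem_ker, map_sub, h₀]
      simp [hx]
    · intro x hx
      have := h₀ x
      rw [LinearMap.mem_ker.1 hx, map_zero] at this
      simpa using this.symm
  obtain ⟨f₁, h₁⟩ := exists_lift pr.proj₁ pr'.d.rangeRestrict pr'.d.surjective_rangeRestrict
    ((f₀.comp pr.d).codRestrict (LinearMap.range pr'.d) (fun x => by
      refine (pr'.exact _).1 ?_
      rw [LinearMap.comp_apply, h₀, LinearMap.comp_apply, pr.p_d, map_zero]))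
  have h₁' : ∀ x, pr'.d (f₁ x) = f₀ (pr.d x) := fun x => congrArg Subtype.val (h₁ x)
  have b₁ : Bijective f₁ := by
    refine bijective_of_superfluous pr'.proj₁ f₁ pr'.min₁ (fun y => ?_) (pr.min₁.mono ?_)
    · obtain ⟨x, hx⟩ := b₀.2 (pr'.d y)
      obtain ⟨z, rfl⟩ := (pr.exact x).1 (by
        apply e.injective
        have := h₀ x
        rw [hx, pr'.p_d] at this
        rw [map_zero]
        exact this.symm)
      exact ⟨z, by rw [LinearMap.mem_ker, map_sub, h₁', hx, sub_self]⟩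
    · intro x hx
      have := h₁' x
      rw [LinearMap.mem_ker.1 hx, map_zero] at this
      exact b₀.1 (by rw [← this, map_zero])
  exact ⟨LinearEquiv.ofBijective f₀ b₀, LinearEquiv.ofBijective f₁ b₁, h₀, h₁'⟩

end

section
variable {R S : Type u} [Ring R] [Ring S]

/-- Minimal presentations of two modules which are transposed to each other. -/
structure TrData (σ : AntiIso R S) (A T : Type u) [AddCommGroup A] [Module R A]
    [AddCommGroup T] [Module S T] : Type (u + 1) where
  pr : MinPres R A
  pr' : MinPres S T
  D1 : DualPair σ pr.P₁ pr'.P₀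
  D0 : DualPair σ pr.P₀ pr'.P₁
  adj : DualPair.Adj D1 D0 pr.d pr'.d

variable {σ : AntiIso R S} {A T A' T' : Type u} [AddCommGroup A] [Module R A]
    [AddCommGroup T] [Module S T] [AddCommGroup A'] [Module R A']
    [AddCommGroup T'] [Module S T']

/-- The transposition relation is symmetric. -/
def TrData.swap (X : TrData σ A T) : TrData σ.symm T A :=
  ⟨X.pr', X.pr, X.D0.swap, X.D1.swap, X.adj.swap⟩

/-- Transport along isomorphisms. -/
def TrData.congr (X : TrData σ A T) (e : A ≃ₗ[R] A') (e' : T ≃ₗ[S] T') : TrData σ A' T' :=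
  ⟨X.pr.congr e, X.pr'.congr e', X.D1, X.D0, X.adj⟩

/-- Compatibility with products. -/
def TrData.prod (X : TrData σ A T) (X' : TrData σ A' T') : TrData σ (A × A') (T × T') :=
  ⟨X.pr.prod X'.pr, X.pr'.prod X'.pr', X.D1.prod X'.D1, X.D0.prod X'.D0, fun p q => by
    change X.D1.b _ (X.pr'.d _) + X'.D1.b _ (X'.pr'.d _) = _
    rw [X.adj, X'.adj]; rfl⟩

/-- The transpose of zero is zero. -/
def TrData.ofSubsingleton (σ : AntiIso R S) [Subsingleton A] [Subsingleton T] : TrData σ A T :=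
  ⟨MinPres.ofFGP FGP.of_subsingleton, MinPres.ofFGP FGP.of_subsingleton,
    @DualPair.ofSubsingleton _ _ _ _ _ _ _ _ _ _ σ (inferInstanceAs (Subsingleton PUnit)) ‹_›,
    @DualPair.ofSubsingleton _ _ _ _ _ _ _ _ _ _ σ ‹_› (inferInstanceAs (Subsingleton PUnit)),
    fun _ _ => rfl⟩

lemma TrData.nonempty_equiv (X : TrData σ A T) (X' : TrData σ A' T') (e : A ≃ₗ[R] A') :
    Nonempty (T ≃ₗ[S] T') := by
  have main : ∀ {A T A' T' : Type u} [AddCommGroup A] [Module R A]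
      [AddCommGroup T] [Module S T] [AddCommGroup A'] [Module R A']
      [AddCommGroup T'] [Module S T'] (X : TrData σ A T) (X' : TrData σ A' T')
      (f₀ : X.pr.P₀ →ₗ[R] X'.pr.P₀) (f₁ : X.pr.P₁ →ₗ[R] X'.pr.P₁)
      (_ : ∀ x, X'.pr.d (f₁ x) = f₀ (X.pr.d x)) (g₁ : X'.pr'.P₀ →ₗ[S] X.pr'.P₀)
      (_ : DualPair.Adj X.D1 X'.D1 f₁ g₁),
      ∃ k : T' →ₗ[S] T, ∀ y, k (X'.pr'.p y) = X.pr'.p (g₁ y) := by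
    intro A T A' T' _ _ _ _ _ _ _ _ X X' f₀ f₁ hf g₁ hg
    refine exists_factor X'.pr'.p X'.pr'.surj (X.pr'.p.comp g₁) fun y hy => ?_
    obtain ⟨y, rfl⟩ := (X'.pr'.exact y).1 hy
    obtain ⟨g₀, hg₀⟩ := DualPair.exists_adj X.D0 X'.D0 f₀
    have : g₁ (X'.pr'.d y) = X.pr'.d (g₀ y) := X.D1.ext_right fun p => by
      rw [hg, X'.adj, hf, X.adj, hg₀]
    rw [LinearMap.comp_apply, this, X.pr'.p_d]
  obtain ⟨f₀, f₁, -, hd⟩ := X.pr.exists_equiv X'.pr e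
  obtain ⟨g₁, hg₁⟩ := DualPair.exists_adj X.D1 X'.D1 f₁.toLinearMap
  obtain ⟨g₁', hg₁'⟩ := DualPair.exists_adj X'.D1 X.D1 f₁.symm.toLinearMap
  obtain ⟨k, hk⟩ := main X X' f₀.toLinearMap f₁.toLinearMap hd g₁ hg₁
  obtain ⟨k', hk'⟩ := main X' X f₀.symm.toLinearMap f₁.symm.toLinearMap (fun x => by
    have := hd (f₁.symm x)
    rw [f₁.apply_symm_apply] at this
    simp [this]) g₁' hg₁'
  refine ⟨LinearEquiv.ofLinearMap k' k (LinearMap.ext fun t => ?_) (LinearMap.ext fun t => ?_)⟩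
  · obtain ⟨y, rfl⟩ := X'.pr'.surj t
    rw [LinearMap.comp_apply, hk, hk']
    exact congrArg _ ((hg₁'.comp hg₁).unique (g' := LinearMap.id) (fun p q => by simp) y)
  · obtain ⟨y, rfl⟩ := X.pr'.surj t
    rw [LinearMap.comp_apply, hk', hk]
    exact congrArg _ ((hg₁.comp hg₁').unique (g' := LinearMap.id) (fun p q => by simp) y)

lemma TrData.noProj [IsArtinianRing S] (X : TrData σ A T) : NoProjSummand R A := by
  refine noProjSummand_of_nilpotent X.pr.finite fun P _ _ hP a b => ?_
  obtain ⟨b', hb'⟩ := exists_lift hP.2 X.pr.p X.pr.surj b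
  obtain ⟨ψ, hψ⟩ := DualPair.exists_adj X.D0 X.D0 ((b'.comp a).comp X.pr.p)
  obtain ⟨n, hn⟩ := nilpotent_of_isSuperfluous X.pr'.fin₁ X.pr'.min₁ ψ fun x =>
    LinearMap.mem_ker.2 ((X.adj.comp hψ).eq_zero (fun p => by simp [X.pr.p_d]) x)
  have h0 := (hψ.pow n).eq_zero' hn
  refine ⟨n, fun x => ?_⟩
  obtain ⟨x, rfl⟩ := X.pr.surj x
  rw [← semiconj_pow_apply ((b'.comp a).comp X.pr.p) (b.comp a) X.pr.p (fun x => hb' _) n x, h0,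
    map_zero]

lemma TrData.of_minPres [IsArtinianRing R] (hA : NoProjSummand R A) (pr : MinPres R A) {Q₁ Q₀ : Type u}
    [AddCommGroup Q₁] [Module S Q₁] [AddCommGroup Q₀] [Module S Q₀] (D1 : DualPair σ pr.P₁ Q₁)
    (D0 : DualPair σ pr.P₀ Q₀) (dt : Q₀ →ₗ[S] Q₁) (hd : DualPair.Adj D1 D0 pr.d dt)
    (q : Q₁ →ₗ[S] T) (hq : Surjective q) (he : Function.Exact dt q) :
    Nonempty (TrData σ A T) := by
  have qd : ∀ x, q (dt x) = 0 := fun x => (he _).2 ⟨x, rfl⟩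
  refine ⟨⟨pr, ⟨Q₀, Q₁, D0.fgpQ.1, D1.fgpQ.1, D0.fgpQ.2, D1.fgpQ.2, dt, q, hq, he, ?_, ?_⟩,
    D1, D0, hd⟩⟩
  · refine isSuperfluous_of_nilpotent D1.fgpQ.2 fun χ hχ => ?_
    obtain ⟨g', hg'⟩ := exists_lift D1.fgpQ.2 dt.rangeRestrict dt.surjective_rangeRestrict
      (χ.codRestrict (LinearMap.range dt) fun x => (he _).1 (hχ x))
    have hχ' : χ = dt.comp g' := LinearMap.ext fun x => (congrArg Subtype.val (hg' x)).symm
    obtain ⟨g, hg⟩ := DualPair.exists_adj' D0 D1 g'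
    obtain ⟨n, hn⟩ := nilpotent_of_isSuperfluous pr.fin₀ pr.min₀ (pr.d.comp g)
      (fun x => pr.p_d _)
    refine ⟨n + 1, ((hχ' ▸ hd.comp hg : DualPair.Adj D1 D1 (g.comp pr.d) χ).pow (n + 1)).eq_zero
      fun p => ?_⟩
    rw [comp_pow_succ_apply, hn, map_zero]
  · refine isSuperfluous_of_nilpotent D0.fgpQ.2 fun ψ hψ => ?_
    obtain ⟨f, hf⟩ := DualPair.exists_adj' D0 D0 ψ
    have h0 := (hd.comp hf).eq_zero' hψ
    obtain ⟨h, hh⟩ := exists_factor pr.p pr.surj f fun x hx => by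
      obtain ⟨y, rfl⟩ := (pr.exact x).1 hx
      exact h0 y
    obtain ⟨n, hn⟩ := hA.nilpotent pr.finite pr.fgp₀ h pr.p
    refine ⟨n + 1, (hf.pow (n + 1)).eq_zero fun p => ?_⟩
    rw [show f = h.comp pr.p from LinearMap.ext fun x => (hh x).symm, comp_pow_succ_apply, hn,
      map_zero]

lemma TrData.exists_of_noProj [IsArtinianRing R] (σ : AntiIso R S) (hfin : Module.Finite R A)
    (hA : NoProjSummand R A) : ∃ (T : Type u) (_ : AddCommGroup T) (_ : Module S T),
      Nonempty (TrData σ A T) := by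
  obtain ⟨pr⟩ := nonempty_minPres hfin
  obtain ⟨Q₁, _, _, ⟨D1⟩⟩ := pr.fgp₁.exists_dualPair σ
  obtain ⟨Q₀, _, _, ⟨D0⟩⟩ := pr.fgp₀.exists_dualPair σ
  obtain ⟨dt, hd⟩ := DualPair.exists_adj D1 D0 pr.d
  exact ⟨_, _, _, TrData.of_minPres hA pr D1 D0 dt hd (LinearMap.range dt).mkQ
    (Submodule.mkQ_surjective _) (LinearMap.exact_map_mkQ_range _)⟩

lemma MinPres.nonempty_trData [IsArtinianRing R] (pr : MinPres R A) (hA : NoProjSummand R A) :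
    Nonempty (TrData (opAnti R) A pr.Tr) := by
  obtain ⟨D1, h1⟩ := pr.fgp₁.exists_dualPair_op
  obtain ⟨D0, h0⟩ := pr.fgp₀.exists_dualPair_op
  exact TrData.of_minPres hA pr D1 D0 pr.dualMap (fun p q => by rw [h1, h0]; rfl)
    (LinearMap.range pr.dualMap).mkQ
    (Submodule.mkQ_surjective _) (LinearMap.exact_map_mkQ_range _)

end

section
variable {R : Type u} [Ring R] {M M' X Y A B : Type u} [AddCommGroup M] [Module R M]
  [AddCommGroup M'] [Module R M'] [AddCommGroup X] [Module R X] [AddCommGroup Y] [Module R Y]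
  [AddCommGroup A] [Module R A] [AddCommGroup B] [Module R B]

lemma IsIndec.congr (h : IsIndec R X) (e : X ≃ₗ[R] Y) : IsIndec R Y := by
  obtain ⟨h1, h2⟩ := h
  refine ⟨e.symm.toEquiv.nontrivial, fun N₁ N₂ hc => ?_⟩
  have := h2 (N₁.map e.symm.toLinearMap) (N₂.map e.symm.toLinearMap)
    (hc.map (Submodule.orderIsoMapComap e.symm))
  simpa [Submodule.map_eq_bot_iff] using this

lemma IsIndec.subsingleton_or (h : IsIndec R X) (e : X ≃ₗ[R] A × B) :
    Subsingleton A ∨ Subsingleton B := by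
  rcases (h.congr e).2 _ _ LinearMap.isCompl_range_inl_inr with h1 | h1
  · left
    refine ⟨fun a b => ?_⟩
    rw [LinearMap.range_eq_bot] at h1
    have h2 := fun a => congrArg Prod.fst (LinearMap.congr_fun h1 a)
    exact (h2 a).trans (h2 b).symm
  · right
    refine ⟨fun a b => ?_⟩
    rw [LinearMap.range_eq_bot] at h1
    have h2 := fun a => congrArg Prod.snd (LinearMap.congr_fun h1 a)
    exact (h2 a).trans (h2 b).symm

lemma IsIndec.of_subsingleton_or (hn : Nontrivial X)
    (h : ∀ (A B : Type u) [AddCommGroup A] [Module R A] [AddCommGroup B] [Module R B],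
      (X ≃ₗ[R] A × B) → Subsingleton A ∨ Subsingleton B) : IsIndec R X := by
  refine ⟨hn, fun N₁ N₂ hc => ?_⟩
  have := h _ _ (Submodule.prodEquivOfIsCompl N₁ N₂ hc).symm
  simpa [Submodule.subsingleton_iff_eq_bot] using this

lemma IsIndec.noProjSummand (h : IsIndec R X) (hp : ¬ Module.Projective R X) :
    NoProjSummand R X := by
  intro N₁ N₂ hc hN
  refine (h.2 N₁ N₂ hc).resolve_right fun h2 => hp ?_
  subst h2
  have h3 : N₁ = ⊤ := by simpa using hc.sup_eq_top
  subst h3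
  exact Module.Projective.of_equiv Submodule.topEquiv

section
variable [IsArtinianRing R]

lemma IsIndec.nilpotent_or_bijective (hfin : Module.Finite R X) (h : IsIndec R X)
    (f : X →ₗ[R] X) : (∃ n : ℕ, ∀ x, (f ^ n) x = 0) ∨ Bijective f := by
  obtain ⟨n, hn, hc⟩ := exists_fitting hfin f
  rcases h.2 _ _ hc with h1 | h1
  · right
    refine IsArtinian.bijective_of_injective_endomorphism f ?_
    obtain ⟨m, rfl⟩ : ∃ m, n = m + 1 := ⟨n - 1, by omega⟩
    refine (injective_iff_map_eq_zero f).2 fun x hx => ?_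
    have : x ∈ LinearMap.ker (f ^ (m + 1)) := by
      rw [LinearMap.mem_ker, pow_succ, Module.End.mul_apply, hx, map_zero]
    rw [h1] at this
    exact this
  · left
    refine ⟨n, fun x => ?_⟩
    have : (f ^ n) x ∈ LinearMap.range (f ^ n) := ⟨x, rfl⟩
    rw [h1] at this
    exact this

lemma IsIndec.bijective_or (hfin : Module.Finite R X) (h : IsIndec R X) (f g : X →ₗ[R] X)
    (hfg : Bijective (f + g : X →ₗ[R] X)) : Bijective f ∨ Bijective g := by
  let u := LinearEquiv.ofBijective (f + g) hfg
  rcases h.nilpotent_or_bijective hfin (u.symm.toLinearMap.comp g) with h1 | h1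
  · left
    have h2 := injective_of_add_nilpotent (u.symm.toLinearMap.comp f) (u.symm.toLinearMap.comp g)
      (fun x => by
        apply u.injective
        simp only [LinearMap.comp_apply, LinearEquiv.coe_coe, map_add, u.apply_symm_apply]
        rfl) h1
    refine IsArtinian.bijective_of_injective_endomorphism f ?_
    rw [LinearMap.coe_comp] at h2
    exact h2.of_comp
  · right
    rw [LinearMap.coe_comp] at h1
    exact (Bijective.of_comp_iff' u.symm.bijective _).1 h1

lemma IsIndec.exists_bijective_of_sum (hfin : Module.Finite R X) (h : IsIndec R X) {ι : Type*}
    (s : Finset ι) (f : ι → (X →ₗ[R] X)) (hf : Bijective (∑ i ∈ s, f i : X →ₗ[R] X)) :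
    ∃ i ∈ s, Bijective (f i) := by
  classical
  induction s using Finset.induction_on with
  | empty =>
    have := h.1
    obtain ⟨x, hx⟩ := exists_ne (0 : X)
    exact absurd (hf.1 (by simp)) hx
  | insert a s ha ih =>
    rw [Finset.sum_insert ha] at hf
    rcases h.bijective_or hfin _ _ hf with h1 | h1
    · exact ⟨a, by simp, h1⟩
    · obtain ⟨i, hi, h2⟩ := ih h1
      exact ⟨i, by simp [hi], h2⟩

lemma IsIndec.nonempty_equiv_of_comp (hY : Module.Finite R Y) (h : IsIndec R X)
    (h' : IsIndec R Y) (i : X →ₗ[R] Y) (p : Y →ₗ[R] X) (hpi : ∀ x, p (i x) = x) :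
    Nonempty (X ≃ₗ[R] Y) := by
  have hi : Injective i := fun a b hab => by rw [← hpi a, hab, hpi]
  refine ⟨LinearEquiv.ofBijective i ⟨hi, ?_⟩⟩
  rcases h'.nilpotent_or_bijective hY (i.comp p) with ⟨n, hn⟩ | h1
  · have := h.1
    obtain ⟨x, hx⟩ := exists_ne (0 : X)
    have key := semiconj_pow_apply (LinearMap.id : X →ₗ[R] X) (i.comp p) i (fun x => by simp [hpi])
      n x
    rw [hn] at key
    refine absurd (hi (key.trans (map_zero i).symm)) ?_
    rwa [show ((LinearMap.id : X →ₗ[R] X) ^ n) = LinearMap.id from one_pow n]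
  · rw [LinearMap.coe_comp] at h1
    exact h1.2.of_comp

/-- A weak form of the Krull-Schmidt theorem. -/
lemma IsIndec.exists_equiv_of_retract {ι : Type} [Fintype ι] {Z : ι → ModuleCat.{u} R}
    (hZ : ∀ i, IsIndec R (Z i)) (hf : ∀ i, Module.Finite R (Z i)) (h : IsIndec R X)
    (i : X →ₗ[R] ∀ j, Z j) (p : (∀ j, Z j) →ₗ[R] X) (hpi : ∀ x, p (i x) = x) :
    ∃ j, Nonempty (X ≃ₗ[R] Z j) := by
  classical
  have hfin : Module.Finite R X := Module.Finite.of_surjective p fun x => ⟨i x, hpi x⟩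
  obtain ⟨j, -, hj⟩ := h.exists_bijective_of_sum hfin Finset.univ
    (fun j => (p.comp (LinearMap.single R (fun j => Z j) j)).comp ((LinearMap.proj j).comp i)) (by
      convert bijective_id (α := X) using 1
      funext x
      rw [LinearMap.sum_apply]
      simp only [LinearMap.comp_apply, LinearMap.proj_apply]
      rw [← map_sum]
      have : ∑ j, (LinearMap.single R (fun j => Z j) j) (i x j) = i x := by
        funext k
        simp [Finset.sum_apply, LinearMap.single_apply]
      rw [this, hpi]
      rfl)
  let u := LinearEquiv.ofBijective _ hj
  refine ⟨j, h.nonempty_equiv_of_comp (hf j) (hZ j) ((LinearMap.proj j).comp i)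
    (u.symm.toLinearMap.comp (p.comp (LinearMap.single R (fun j => Z j) j))) fun x => ?_⟩
  exact u.symm_apply_apply x

end

/-- `M` is the direct sum of the given finite family of indecomposable modules. -/
def IsDecomp (R : Type u) [Ring R] (M : Type u) [AddCommGroup M] [Module R M] {ι : Type}
    (X : ι → ModuleCat.{u} R) : Prop :=
  (∀ i, IsIndec R (X i)) ∧ Nonempty (M ≃ₗ[R] ∀ i, X i)

lemma IsDecomp.finite {ι : Type} {Z : ι → ModuleCat.{u} R} (h : IsDecomp R M Z)
    (hM : Module.Finite R M) (i : ι) : Module.Finite R (Z i) := by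
  classical
  obtain ⟨-, ⟨e⟩⟩ := h
  exact Module.Finite.of_surjective
    ((LinearMap.proj (R := R) (φ := fun j => Z j) i).comp e.toLinearMap) fun x =>
      ⟨e.symm (Pi.single i x), by simp⟩

lemma isDecomp_of_isInternal {n : ℕ} {N : Fin n → Submodule R M} (h : DirectSum.IsInternal N)
    (hN : ∀ i, IsIndec R (N i)) : IsDecomp R M fun i => ModuleCat.of R (N i) :=
  ⟨hN, ⟨(LinearEquiv.ofBijective (DirectSum.coeLinearMap N) h).symm.trans
    (DirectSum.linearEquivFunOnFintype R (Fin n) fun i => N i)⟩⟩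

lemma IsDecomp.exists_isInternal {n : ℕ} {Z : Fin n → ModuleCat.{u} R} (h : IsDecomp R M Z) :
    ∃ N : Fin n → Submodule R M, DirectSum.IsInternal N ∧ (∀ i, IsIndec R (N i)) ∧
      ∀ i, Nonempty (N i ≃ₗ[R] Z i) := by
  obtain ⟨h1, ⟨e⟩⟩ := h
  let s : ∀ i, Z i →ₗ[R] M := fun i =>
    e.symm.toLinearMap.comp (LinearMap.single R (fun j => Z j) i)
  have hs : ∀ i, Injective (s i) := fun i => by
    rw [LinearMap.coe_comp]
    exact e.symm.injective.comp (Pi.single_injective (M := fun j => Z j) i)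
  let f : ∀ i, Z i ≃ₗ[R] LinearMap.range (s i) := fun i => LinearEquiv.ofInjective (s i) (hs i)
  refine ⟨fun i => LinearMap.range (s i), ?_, fun i => (h1 i).congr (f i), fun i => ⟨(f i).symm⟩⟩
  let g := ((DirectSum.linearEquivFunOnFintype R (Fin n) fun i => LinearMap.range (s i)).trans
    (LinearEquiv.piCongrRight fun i => (f i).symm)).trans e.symm
  have hg : DirectSum.coeLinearMap (fun i => LinearMap.range (s i)) = g.toLinearMap := by
    refine DirectSum.linearMap_ext R fun i => LinearMap.ext fun x => ?_
    obtain ⟨x, rfl⟩ := (f i).surjective x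
    simp only [LinearMap.comp_apply, DirectSum.coeLinearMap_lof, g, LinearEquiv.coe_coe,
      LinearEquiv.trans_apply, DirectSum.linearEquivFunOnFintype_lof]
    change e.symm _ = e.symm _
    congr 1
    funext j
    change _ = (f j).symm _
    by_cases hij : j = i
    · subst hij
      simp
    · simp [LinearMap.single_apply, Pi.single_eq_of_ne hij]
  have := g.bijective
  change Bijective g.toLinearMap at this
  rw [← hg] at this
  exact this

lemma IsDecomp.reindex {ι κ : Type} {Z : ι → ModuleCat.{u} R} (h : IsDecomp R M Z) (e : κ ≃ ι) :
    IsDecomp R M fun k => Z (e k) :=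
  ⟨fun _ => h.1 _, h.2.map fun f =>
    f.trans (LinearEquiv.piCongrLeft R (fun i => Z i) e).symm⟩

lemma IsDecomp.isBasic {ι : Type} [Fintype ι] {Z : ι → ModuleCat.{u} R} (h : IsDecomp R M Z)
    (hZ : ∀ i j, Nonempty (Z i ≃ₗ[R] Z j) → i = j) : IsBasic R M := by
  obtain ⟨N, h1, h2, h3⟩ := (h.reindex (Fintype.equivFin ι).symm).exists_isInternal
  refine ⟨_, N, h1, h2, fun i j hij ⟨e⟩ => hij ?_⟩
  obtain ⟨ei⟩ := h3 i
  obtain ⟨ej⟩ := h3 j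
  exact (Fintype.equivFin ι).symm.injective (hZ _ _ ⟨(ei.symm.trans e).trans ej⟩)

lemma IsDecomp.numIndec {ι : Type} [Fintype ι] {Z : ι → ModuleCat.{u} R} (h : IsDecomp R M Z)
    {k : ℕ} (c : ι → Fin k) (hs : Surjective c)
    (hc : ∀ i j, c i = c j ↔ Nonempty (Z i ≃ₗ[R] Z j)) : NumIndec R M k := by
  obtain ⟨N, h1, h2, h3⟩ := (h.reindex (Fintype.equivFin ι).symm).exists_isInternal
  refine ⟨_, N, h1, h2, fun i => c ((Fintype.equivFin ι).symm i),
    hs.comp (Fintype.equivFin ι).symm.surjective, fun i j => ?_⟩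
  rw [hc]
  obtain ⟨ei⟩ := h3 i
  obtain ⟨ej⟩ := h3 j
  exact ⟨fun ⟨e⟩ => ⟨(ei.trans e).trans ej.symm⟩, fun ⟨e⟩ => ⟨(ei.symm.trans e).trans ej⟩⟩

lemma IsBasic.exists_isDecomp (h : IsBasic R M) : ∃ (n : ℕ) (Z : Fin n → ModuleCat.{u} R),
    IsDecomp R M Z ∧ ∀ i j, Nonempty (Z i ≃ₗ[R] Z j) → i = j := by
  obtain ⟨n, N, h1, h2, h3⟩ := h
  exact ⟨n, _, isDecomp_of_isInternal h1 h2, fun i j hij => by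
    by_contra hne
    exact h3 i j hne hij⟩

lemma NumIndec.exists_isDecomp {k : ℕ} (h : NumIndec R M k) :
    ∃ (n : ℕ) (Z : Fin n → ModuleCat.{u} R) (c : Fin n → Fin k), IsDecomp R M Z ∧ Surjective c ∧
      ∀ i j, c i = c j ↔ Nonempty (Z i ≃ₗ[R] Z j) := by
  obtain ⟨n, N, h1, h2, c, h3, h4⟩ := h
  exact ⟨n, _, c, isDecomp_of_isInternal h1 h2, h3, h4⟩

lemma IsDecomp.congr {ι : Type} {Z : ι → ModuleCat.{u} R} (h : IsDecomp R M Z)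
    (e : M ≃ₗ[R] M') : IsDecomp R M' Z := ⟨h.1, h.2.map fun f => e.symm.trans f⟩

lemma IsBasic.congr (h : IsBasic R M) (e : M ≃ₗ[R] M') : IsBasic R M' := by
  obtain ⟨n, Z, h1, h2⟩ := h.exists_isDecomp
  exact (h1.congr e).isBasic h2

lemma NumIndec.congr {k : ℕ} (h : NumIndec R M k) (e : M ≃ₗ[R] M') : NumIndec R M' k := by
  obtain ⟨n, Z, c, h1, h2, h3⟩ := h.exists_isDecomp
  exact (h1.congr e).numIndec c h2 h3

lemma IsDecomp.numIndec_card {ι : Type} [Fintype ι] {Z : ι → ModuleCat.{u} R}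
    (h : IsDecomp R M Z) (hZ : ∀ i j, Nonempty (Z i ≃ₗ[R] Z j) → i = j) :
    NumIndec R M (Fintype.card ι) :=
  h.numIndec (Fintype.equivFin ι) (Fintype.equivFin ι).surjective fun i j =>
    ⟨fun hij => by
      rw [(Fintype.equivFin ι).injective hij]
      exact ⟨LinearEquiv.refl _ _⟩, fun hij => congrArg _ (hZ i j hij)⟩

lemma IsDecomp.exists_equiv [IsArtinianRing R] (hM : Module.Finite R M) {ι κ : Type} [Fintype κ]
    {Z : ι → ModuleCat.{u} R} {Z' : κ → ModuleCat.{u} R}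
    (h : IsDecomp R M Z) (h' : IsDecomp R M Z') (i : ι) : ∃ j, Nonempty (Z i ≃ₗ[R] Z' j) := by
  classical
  obtain ⟨h1, ⟨e⟩⟩ := h
  have hf := h'.finite hM
  obtain ⟨h1', ⟨e'⟩⟩ := h'
  refine (h1 i).exists_equiv_of_retract h1' hf
    ((e'.toLinearMap.comp e.symm.toLinearMap).comp (LinearMap.single R (fun j => Z j) i))
    (((LinearMap.proj i).comp e.toLinearMap).comp e'.symm.toLinearMap) fun x => ?_
  simp

lemma IsDecomp.card_eq [IsArtinianRing R] (hM : Module.Finite R M) {ι : Type} [Fintype ι]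
    {Z : ι → ModuleCat.{u} R} (h : IsDecomp R M Z)
    (hZ : ∀ i j, Nonempty (Z i ≃ₗ[R] Z j) → i = j) {k : ℕ} (hk : NumIndec R M k) :
    k = Fintype.card ι := by
  obtain ⟨n, Z', c, h', hs, hc⟩ := hk.exists_isDecomp
  choose f hf using fun i => h.exists_equiv hM h' i
  have hb : Bijective fun i => c (f i) := by
    constructor
    · intro i j hij
      obtain ⟨e⟩ := (hc _ _).1 hij
      obtain ⟨ei⟩ := hf i
      obtain ⟨ej⟩ := hf j
      exact hZ _ _ ⟨(ei.trans e).trans ej.symm⟩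
    · intro y
      obtain ⟨j, rfl⟩ := hs y
      obtain ⟨i, ⟨e⟩⟩ := h'.exists_equiv hM h j
      obtain ⟨ei⟩ := hf i
      exact ⟨i, (hc _ _).2 ⟨(e.trans ei).symm⟩⟩
  rw [Fintype.card_of_bijective hb, Fintype.card_fin]

/-- Splitting a product of modules according to a predicate on the index set. -/
noncomputable def piSplit {ι : Type} (Z : ι → ModuleCat.{u} R) (p : ι → Prop) :
    (∀ i, Z i) ≃ₗ[R] (∀ i : {i // p i}, Z i) × (∀ i : {i // ¬ p i}, Z i) := by
  classical
  exact (LinearEquiv.piCongrLeft R (fun i => Z i) (Equiv.sumCompl p)).symm.trans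
    (LinearEquiv.sumPiEquivProdPi R _ _ fun k => Z (Equiv.sumCompl p k))

end

section
variable {R : Type u} [Ring R]

lemma NoProjSummand.of_retract [IsArtinianRing R] {A B : Type u} [AddCommGroup A] [Module R A]
    [AddCommGroup B] [Module R B] (hA : Module.Finite R A) (h : NoProjSummand R A)
    (i : B →ₗ[R] A) (p : A →ₗ[R] B) (hpi : ∀ x, p (i x) = x) : NoProjSummand R B := by
  refine noProjSummand_of_nilpotent (Module.Finite.of_surjective p fun x => ⟨i x, hpi x⟩)
    fun P _ _ hP a b => ?_
  obtain ⟨n, hn⟩ := h.nilpotent hA hP (a.comp p) (i.comp b)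
  refine ⟨n, fun x => ?_⟩
  have := semiconj_pow_apply (b.comp a) ((i.comp b).comp (a.comp p)) i
    (fun x => by simp [hpi]) n x
  rw [hn] at this
  rw [← hpi (((b.comp a) ^ n) x), this, map_zero]

lemma NoProjSummand.subsingleton {A : Type u} [AddCommGroup A] [Module R A]
    (h : NoProjSummand R A) (hA : Module.Projective R A) : Subsingleton A := by
  have := h ⊤ ⊥ isCompl_top_bot (Module.Projective.of_equiv Submodule.topEquiv.symm)
  have : Subsingleton (⊤ : Submodule R A) := Submodule.subsingleton_iff_eq_bot.2 this
  exact (Submodule.topEquiv (R := R) (M := A)).symm.toEquiv.subsingleton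

end

variable {R S : Type u} [Ring R] [Ring S]

/-- A relation between modules over two rings which behaves like the graph of a duality on
isomorphism classes. -/
structure IsDuality (Rel : ModuleCat.{u} R → ModuleCat.{u} S → Prop) : Prop where
  congr : ∀ {A A' : ModuleCat.{u} R} {T T' : ModuleCat.{u} S},
    Rel A T → (A ≃ₗ[R] A') → (T ≃ₗ[S] T') → Rel A' T'
  prod : ∀ {A A' : ModuleCat.{u} R} {T T' : ModuleCat.{u} S},
    Rel A T → Rel A' T' → Rel (.of R (A × A')) (.of S (T × T'))
  zero : ∀ {A : ModuleCat.{u} R} {T : ModuleCat.{u} S}, Subsingleton A → Subsingleton T → Rel A T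
  uniq : ∀ {A A' : ModuleCat.{u} R} {T T' : ModuleCat.{u} S},
    Rel A T → Rel A' T' → (A ≃ₗ[R] A') → Nonempty (T ≃ₗ[S] T')
  uniq' : ∀ {A A' : ModuleCat.{u} R} {T T' : ModuleCat.{u} S},
    Rel A T → Rel A' T' → (T ≃ₗ[S] T') → Nonempty (A ≃ₗ[R] A')
  summand : ∀ {A : ModuleCat.{u} R} {T T₁ T₂ : ModuleCat.{u} S},
    Rel A T → (T ≃ₗ[S] T₁ × T₂) → ∃ A₁, Rel A₁ T₁

namespace IsDuality
variable {Rel : ModuleCat.{u} R → ModuleCat.{u} S → Prop}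

lemma pi_fin (h : IsDuality Rel) (n : ℕ) (X : Fin n → ModuleCat.{u} R) (Y : Fin n → ModuleCat.{u} S)
    (hXY : ∀ i, Rel (X i) (Y i)) : Rel (.of R (∀ i, X i)) (.of S (∀ i, Y i)) := by
  induction n with
  | zero =>
    have h1 : Subsingleton (∀ i, X i) := inferInstance
    have h2 : Subsingleton (∀ i, Y i) := inferInstance
    exact h.zero h1 h2
  | succ n ih =>
    exact h.congr (h.prod (hXY 0) (ih _ _ fun i => hXY i.succ))
      (Fin.consLinearEquiv R fun i => X i) (Fin.consLinearEquiv S fun i => Y i)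

lemma pi (h : IsDuality Rel) {ι : Type} [Fintype ι] {X : ι → ModuleCat.{u} R} {Y : ι → ModuleCat.{u} S}
    (hXY : ∀ i, Rel (X i) (Y i)) : Rel (.of R (∀ i, X i)) (.of S (∀ i, Y i)) :=
  h.congr (h.pi_fin _ _ _ fun k => hXY ((Fintype.equivFin ι).symm k))
    (LinearEquiv.piCongrLeft R (fun i => X i) (Fintype.equivFin ι).symm)
    (LinearEquiv.piCongrLeft S (fun i => Y i) (Fintype.equivFin ι).symm)

lemma subsingleton' (h : IsDuality Rel) {A : ModuleCat.{u} R} {T : ModuleCat.{u} S} (hr : Rel A T)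
    (hT : Subsingleton T) : Subsingleton A := by
  obtain ⟨e⟩ := h.uniq' hr (h.zero (A := .of R PUnit.{u + 1}) (T := .of S PUnit.{u + 1})
    (inferInstanceAs (Subsingleton PUnit.{u + 1})) (inferInstanceAs (Subsingleton PUnit.{u + 1})))
    (LinearEquiv.ofSubsingleton T PUnit.{u + 1})
  exact e.toEquiv.subsingleton_congr.2 (inferInstanceAs (Subsingleton PUnit.{u + 1}))

lemma subsingleton (h : IsDuality Rel) {A : ModuleCat.{u} R} {T : ModuleCat.{u} S} (hr : Rel A T)
    (hA : Subsingleton A) : Subsingleton T := by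
  obtain ⟨e⟩ := h.uniq hr (h.zero (A := .of R PUnit.{u + 1}) (T := .of S PUnit.{u + 1})
    (inferInstanceAs (Subsingleton PUnit.{u + 1})) (inferInstanceAs (Subsingleton PUnit.{u + 1})))
    (LinearEquiv.ofSubsingleton A PUnit.{u + 1})
  exact e.toEquiv.subsingleton_congr.2 (inferInstanceAs (Subsingleton PUnit.{u + 1}))

lemma isIndec (h : IsDuality Rel) {A : ModuleCat.{u} R} {T : ModuleCat.{u} S} (hr : Rel A T)
    (hA : IsIndec R A) : IsIndec S T := by
  refine IsIndec.of_subsingleton_or ?_ fun T₁ T₂ _ _ _ _ e => ?_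
  · by_contra hT
    exact not_subsingleton_iff_nontrivial.2 hA.1
      (h.subsingleton' hr (not_nontrivial_iff_subsingleton.1 hT))
  · obtain ⟨A₁, h₁⟩ := h.summand (T₁ := .of S T₁) (T₂ := .of S T₂) hr e
    obtain ⟨A₂, h₂⟩ := h.summand (T₁ := .of S T₂) (T₂ := .of S T₁) hr
      (e.trans (LinearEquiv.prodComm S T₁ T₂))
    obtain ⟨f⟩ := h.uniq' hr (h.prod h₁ h₂) e
    exact (hA.subsingleton_or f).imp (h.subsingleton h₁) (h.subsingleton h₂)

end IsDuality

section

lemma isDuality_dualPair (σ : AntiIso R S) : IsDuality fun (A : ModuleCat.{u} R) (T : ModuleCat.{u} S) =>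
    Nonempty (DualPair σ A T) where
  congr := fun ⟨D⟩ e e' => ⟨D.congr e e'⟩
  prod := fun ⟨D⟩ ⟨D'⟩ => ⟨D.prod D'⟩
  zero := fun _ _ => ⟨DualPair.ofSubsingleton σ⟩
  uniq := fun ⟨D⟩ ⟨D'⟩ e => D.nonempty_equiv D' e
  uniq' := fun ⟨D⟩ ⟨D'⟩ e => D.swap.nonempty_equiv D'.swap e
  summand := fun {A T T₁ T₂} ⟨D⟩ e => by
    obtain ⟨P, _, _, hP⟩ := FGP.exists_dualPair' σ (B := T₁) (D.fgpQ.of_retract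
      (e.symm.toLinearMap.comp (LinearMap.inl S T₁ T₂))
      ((LinearMap.fst S T₁ T₂).comp e.toLinearMap) (by simp))
    exact ⟨.of R P, hP⟩

lemma isDuality_trData (σ : AntiIso R S) [IsArtinianRing R] [IsArtinianRing S] :
    IsDuality fun (A : ModuleCat.{u} R) (T : ModuleCat.{u} S) => Nonempty (TrData σ A T) where
  congr := fun ⟨D⟩ e e' => ⟨D.congr e e'⟩
  prod := fun ⟨D⟩ ⟨D'⟩ => ⟨D.prod D'⟩
  zero := fun _ _ => ⟨TrData.ofSubsingleton σ⟩
  uniq := fun ⟨D⟩ ⟨D'⟩ e => D.nonempty_equiv D' e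
  uniq' := fun ⟨D⟩ ⟨D'⟩ e => D.swap.nonempty_equiv D'.swap e
  summand := fun {A T T₁ T₂} ⟨D⟩ e => by
    have hT := D.pr'.finite
    obtain ⟨P, _, _, ⟨X⟩⟩ := TrData.exists_of_noProj σ.symm (A := T₁)
      (Module.Finite.of_surjective ((LinearMap.fst S T₁ T₂).comp e.toLinearMap)
        fun t => ⟨e.symm (t, 0), by simp⟩)
      (D.swap.noProj.of_retract hT (e.symm.toLinearMap.comp (LinearMap.inl S T₁ T₂))
      ((LinearMap.fst S T₁ T₂).comp e.toLinearMap) (by simp))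
    exact ⟨.of R P, ⟨X.swap⟩⟩

lemma NumIndec.ring_of_antiIso (σ : AntiIso R S) {l : ℕ} (h : NumIndec R R l) : NumIndec S S l := by
  obtain ⟨n, Z, c, ⟨h1, ⟨e⟩⟩, hs, hc⟩ := h.exists_isDecomp
  classical
  have hZ : ∀ i, ∃ Q : ModuleCat.{u} S, Nonempty (DualPair σ (Z i) Q) := fun i => by
    have : FGP R (Z i) := FGP.ring.of_retract
      (e.symm.toLinearMap.comp (LinearMap.single R (fun j => Z j) i))
      ((LinearMap.proj i).comp e.toLinearMap) (by simp)
    obtain ⟨Q, _, _, hQ⟩ := this.exists_dualPair σ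
    exact ⟨.of S Q, hQ⟩
  choose Q hQ using hZ
  obtain ⟨f⟩ := (isDuality_dualPair σ).uniq (A := .of R R) (T := .of S S) ⟨DualPair.ring σ⟩
    ((isDuality_dualPair σ).pi hQ) e
  refine IsDecomp.numIndec (Z := Q) ⟨fun i => (isDuality_dualPair σ).isIndec (hQ i) (h1 i), ⟨f⟩⟩
    c hs fun i j => ?_
  rw [hc]
  exact ⟨fun ⟨g⟩ => (isDuality_dualPair σ).uniq (hQ i) (hQ j) g,
    fun ⟨g⟩ => (isDuality_dualPair σ).uniq' (hQ i) (hQ j) g⟩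

end

section
variable {R : Type u} [Ring R]

lemma exists_injective_of_prod_equiv {B C B' C' : Type u} [AddCommGroup B] [Module R B]
    [AddCommGroup C] [Module R C] [AddCommGroup B'] [Module R B'] [AddCommGroup C'] [Module R C']
    (e : (B × C) ≃ₗ[R] B' × C')
    (h : (∀ (a : B →ₗ[R] C') (b : C' →ₗ[R] B), ∃ n : ℕ, ∀ x, ((b.comp a) ^ n) x = 0)) :
    ∃ f : B →ₗ[R] B', Injective f := by
  let f := ((LinearMap.fst R B' C').comp e.toLinearMap).comp (LinearMap.inl R B C)
  let g := ((LinearMap.snd R B' C').comp e.toLinearMap).comp (LinearMap.inl R B C)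
  let f' := ((LinearMap.fst R B C).comp e.symm.toLinearMap).comp (LinearMap.inl R B' C')
  let g' := ((LinearMap.fst R B C).comp e.symm.toLinearMap).comp (LinearMap.inr R B' C')
  refine ⟨f, ?_⟩
  have h1 := injective_of_add_nilpotent (f'.comp f) (g'.comp g) (fun x => by
    have h2 : (e.symm (((e (x, 0)).1, (0 : C')) + ((0 : B'), (e (x, 0)).2))).1 = x := by
      simp
    rw [map_add] at h2
    exact h2) (h g g')
  rw [LinearMap.coe_comp] at h1
  exact h1.of_comp

lemma NoProjSummand.nilpotent' [IsArtinianRing R] {A P : Type u} [AddCommGroup A] [Module R A] [AddCommGroup P]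
    [Module R P] (hA : Module.Finite R A)
    (h : NoProjSummand R A) (hP : FGP R P) (a : P →ₗ[R] A) (b : A →ₗ[R] P) :
    ∃ n : ℕ, ∀ x, ((b.comp a) ^ n) x = 0 := by
  obtain ⟨n, hn⟩ := h.nilpotent hA hP b a
  exact ⟨n + 1, fun x => by rw [comp_pow_succ_apply, hn, map_zero]⟩

/-- The decomposition into a projective part and a part without projective summands is unique. -/
lemma splitting_unique [IsArtinianRing R] {P A P' A' : Type u} [AddCommGroup P] [Module R P]
    [AddCommGroup A] [Module R A] [AddCommGroup P'] [Module R P'] [AddCommGroup A'] [Module R A']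
    (hP : FGP R P) (hP' : FGP R P') (hA : Module.Finite R A) (hA' : Module.Finite R A')
    (h : NoProjSummand R A) (h' : NoProjSummand R A') (e : (P × A) ≃ₗ[R] P' × A') :
    Nonempty (P ≃ₗ[R] P') ∧ Nonempty (A ≃ₗ[R] A') := by
  obtain ⟨f, hf⟩ := exists_injective_of_prod_equiv e (fun a b => h'.nilpotent' hA' hP a b)
  obtain ⟨f', hf'⟩ := exists_injective_of_prod_equiv e.symm (fun a b => h.nilpotent' hA hP' a b)
  let s := ((LinearEquiv.prodComm R A P).trans e).trans (LinearEquiv.prodComm R P' A')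
  obtain ⟨g, hg⟩ := exists_injective_of_prod_equiv s (fun a b => h.nilpotent hA hP' a b)
  obtain ⟨g', hg'⟩ := exists_injective_of_prod_equiv s.symm (fun a b => h'.nilpotent hA' hP a b)
  exact ⟨nonempty_equiv_of_injective hP.1 f hf f' hf', nonempty_equiv_of_injective hA g hg g' hg'⟩

end

section
variable {R : Type u} [Ring R] {M : Type u} [AddCommGroup M] [Module R M]

lemma sum_dual_basis_apply {P : Type u} [AddCommGroup P] [Module R P] {n : ℕ}
    {α : Fin n → (P →ₗ[R] R)} {v : Fin n → P} (h : ∀ p, ∑ i, α i p • v i = p) (k : P →ₗ[R] M)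
    (p : P) : ∑ i, α i p • k (v i) = k p := by
  conv_rhs => rw [← h p]
  simp

variable {K : Type u} [Field K] [Algebra K R]

lemma MinPres.hom_tau_eq_zero (pr : MinPres R M)
    (h : ∀ f : pr.P₁ →ₗ[R] M, ∃ k : pr.P₀ →ₗ[R] M, k.comp pr.d = f) (f : M →ₗ[R] pr.tau K) :
    f = 0 := by
  obtain ⟨n, α, w, hw⟩ := pr.fgp₁.dual_basis
  obtain ⟨m, β, v, hv⟩ := pr.fgp₀.dual_basis
  let B : M → (pr.P₁ →ₗ[R] R) → K := fun x a => OpDual.toL R K pr.Tr (f x) (pr.toTr a)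
  have B_add : ∀ x y a, B (x + y) a = B x a + B y a := fun x y a => by
    simp only [B, map_add]
    rfl
  have B_add' : ∀ x a b, B x (a + b) = B x a + B x b := fun x a b =>
    map_add (OpDual.toL R K pr.Tr (f x)) (pr.toTr a) (pr.toTr b)
  have B_smul : ∀ (r : R) x a, B (r • x) a = B x (op r • a) := fun r x a => by
    simp only [B, map_smul]
    rfl
  have B_zero : ∀ x, B x 0 = 0 := fun x => map_zero (OpDual.toL R K pr.Tr (f x))
  have B_d : ∀ x (b : pr.P₀ →ₗ[R] R), B x (b.comp pr.d) = 0 := fun x b => by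
    have : pr.toTr (b.comp pr.d) = 0 :=
      (Submodule.Quotient.mk_eq_zero _).2 ⟨b, rfl⟩
    simp only [B, this, map_zero]
  let Bx : M → ((pr.P₁ →ₗ[R] R) →+ K) := fun x => ⟨⟨B x, B_zero x⟩, B_add' x⟩
  let By : (pr.P₁ →ₗ[R] R) → (M →+ K) := fun a => AddMonoidHom.mk' (fun x => B x a)
    fun x y => B_add x y a
  have key : ∀ x (a : pr.P₁ →ₗ[R] R), ∑ j, B (a (w j) • x) (α j) = B x a := fun x a => by
    simp only [B_smul]
    refine (map_sum (Bx x) (fun j => op (a (w j)) • α j) Finset.univ).symm.trans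
      (congrArg (B x) (LinearMap.ext fun u => ?_))
    rw [LinearMap.sum_apply]
    exact sum_dual_basis_apply hw a u
  refine LinearMap.ext fun x => ?_
  refine OpDual.toL_injective R K pr.Tr (LinearMap.ext fun t => ?_)
  obtain ⟨a, rfl⟩ := Submodule.mkQ_surjective _ t
  change B x a = 0
  obtain ⟨k, hk⟩ := h (a.smulRight x)
  rw [← key]
  have h1 : ∀ j, a (w j) • x = ∑ i, β i (pr.d (w j)) • k (v i) := fun j => by
    rw [sum_dual_basis_apply hv]
    exact (LinearMap.congr_fun hk (w j)).symm
  have h2 : ∀ j, B (a (w j) • x) (α j) = ∑ i, B (β i (pr.d (w j)) • k (v i)) (α j) := fun j => by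
    rw [h1]
    exact map_sum (By (α j)) _ _
  rw [Finset.sum_congr rfl fun j _ => h2 j, Finset.sum_comm]
  refine Finset.sum_eq_zero fun i _ => ?_
  rw [← B_d (k (v i)) (β i), ← key]
  rfl

/-- The canonical projection onto the transpose as a `K`-linear map. -/
def MinPres.toTrK (K : Type u) [Field K] [Algebra K R] (pr : MinPres R M) :
    (pr.P₁ →ₗ[R] R) →ₗ[K] pr.Tr where
  toFun := pr.toTr
  map_add' _ _ := rfl
  map_smul' _ _ := rfl

lemma MinPres.exists_factor_of_hom_tau [Module K M] [IsScalarTower K R M] (pr : MinPres R M)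
    (h : ∀ f : M →ₗ[R] pr.tau K, f = 0) (f : pr.P₁ →ₗ[R] M) :
    ∃ k : pr.P₀ →ₗ[R] M, k.comp pr.d = f := by
  let W : Submodule K (pr.P₁ →ₗ[R] M) :=
    { carrier := {f | ∃ k : pr.P₀ →ₗ[R] M, k.comp pr.d = f}
      zero_mem' := ⟨0, LinearMap.zero_comp _⟩
      add_mem' := by
        rintro _ _ ⟨k, rfl⟩ ⟨k', rfl⟩
        exact ⟨k + k', LinearMap.add_comp _ _ _⟩
      smul_mem' := by
        rintro c _ ⟨k, rfl⟩
        exact ⟨c • k, LinearMap.smul_comp _ _ _⟩ }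
  suffices W = ⊤ from (this ▸ Submodule.mem_top : f ∈ W)
  by_contra hW
  obtain ⟨β, hβ, hle⟩ := Submodule.exists_le_ker_of_lt_top W (lt_top_iff_ne_top.2 hW)
  let sR : M → ((pr.P₁ →ₗ[R] R) →ₗ[K] (pr.P₁ →ₗ[R] M)) := fun x =>
    { toFun := fun a => a.smulRight x
      map_add' := fun a b => LinearMap.ext fun u => add_smul _ _ _
      map_smul' := fun c a => LinearMap.ext fun u => by
        change (c • a u) • x = c • (a u • x)
        exact smul_assoc c (a u) x }
  have hg : ∀ x : M, ∃ g : pr.Tr →ₗ[K] K, ∀ a, g (pr.toTrK K a) = β (a.smulRight x) := fun x =>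
    exists_factor (pr.toTrK K) (Submodule.mkQ_surjective (LinearMap.range pr.dualMap))
      (β.comp (sR x)) fun a ha => by
        obtain ⟨b, hb⟩ := (Submodule.Quotient.mk_eq_zero (LinearMap.range pr.dualMap)).1 ha
        refine hle ⟨b.smulRight x, LinearMap.ext fun u => ?_⟩
        rw [← hb]
        rfl
  choose g hg using hg
  have hext : ∀ φ ψ : pr.tau K, (∀ a, OpDual.toL R K pr.Tr φ (pr.toTrK K a) =
      OpDual.toL R K pr.Tr ψ (pr.toTrK K a)) → φ = ψ := fun φ ψ hφ =>
    OpDual.toL_injective R K pr.Tr (LinearMap.ext fun t => by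
      obtain ⟨a, rfl⟩ := Submodule.mkQ_surjective _ t
      exact hφ a)
  let F : M →ₗ[R] pr.tau K :=
    { toFun := g
      map_add' := fun x y => hext _ _ fun a => by
        refine (hg _ a).trans ?_
        refine Eq.trans ?_ (congrArg₂ (· + ·) (hg x a) (hg y a)).symm
        rw [← map_add]
        exact congrArg β (LinearMap.ext fun u => smul_add _ _ _)
      map_smul' := fun r x => hext _ _ fun a => by
        refine (hg _ a).trans ?_
        refine Eq.trans ?_ (hg x (op r • a)).symm
        exact congrArg β (LinearMap.ext fun u => (mul_smul (a u) r x).symm) }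
  have hF : ∀ x a, β (LinearMap.smulRight a x) = 0 := fun x a => by
    rw [← hg x a]
    have h1 : F x = 0 := by rw [h F]; rfl
    exact LinearMap.congr_fun (congrArg (OpDual.toL R K pr.Tr) h1) _
  obtain ⟨n, α, w, hw⟩ := pr.fgp₁.dual_basis
  refine hβ (LinearMap.ext fun k => ?_)
  have hk : k = ∑ j, (α j).smulRight (k (w j)) := LinearMap.ext fun u => by
    rw [LinearMap.sum_apply]
    exact (sum_dual_basis_apply hw k u).symm
  rw [hk, map_sum]
  exact Finset.sum_eq_zero fun j _ => hF _ _

lemma MinPres.factor_of_equiv {A A' : Type u} [AddCommGroup A] [Module R A] [AddCommGroup A']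
    [Module R A'] (pr : MinPres R A) (pr' : MinPres R A')
    (e : A ≃ₗ[R] A') (h : ∀ f : pr.P₁ →ₗ[R] M, ∃ k : pr.P₀ →ₗ[R] M, k.comp pr.d = f)
    (f : pr'.P₁ →ₗ[R] M) : ∃ k : pr'.P₀ →ₗ[R] M, k.comp pr'.d = f := by
  obtain ⟨f₀, f₁, -, hd⟩ := pr.exists_equiv pr' e
  obtain ⟨k, hk⟩ := h (f.comp f₁.toLinearMap)
  refine ⟨k.comp f₀.symm.toLinearMap, LinearMap.ext fun x => ?_⟩
  have h1 := hd (f₁.symm x)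
  have h2 := LinearMap.congr_fun hk (f₁.symm x)
  simp only [LinearMap.comp_apply, LinearEquiv.coe_coe, f₁.apply_symm_apply] at h1 h2 ⊢
  rw [h1, f₀.symm_apply_apply, h2]

variable {P A : Type u} [AddCommGroup P] [Module R P] [AddCommGroup A] [Module R A]

lemma isTauRigid_of_factor (hP : FGP R P) (pr : MinPres R A) (e : M ≃ₗ[R] P × A)
    (h : ∀ f : pr.P₁ →ₗ[R] M, ∃ k : pr.P₀ →ₗ[R] M, k.comp pr.d = f) : IsTauRigid R K M := by
  intro pr'
  refine pr'.hom_tau_eq_zero (((MinPres.ofFGP hP).prod pr).factor_of_equiv pr' e.symm fun f => ?_)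
  obtain ⟨k, hk⟩ := h (f.comp (LinearMap.inr R _ _))
  refine ⟨k.comp (LinearMap.snd R _ _), LinearMap.ext fun x => ?_⟩
  have h1 : x = (0, x.2) := Prod.ext (Subsingleton.elim (α := PUnit) _ _) rfl
  have h2 := LinearMap.congr_fun hk x.2
  rw [h1]
  exact h2

lemma IsTauRigid.exists_factor [Module K M] [IsScalarTower K R M] (hM : IsTauRigid R K M)
    (hP : FGP R P) (pr : MinPres R A) (e : M ≃ₗ[R] P × A) (f : pr.P₁ →ₗ[R] M) :
    ∃ k : pr.P₀ →ₗ[R] M, k.comp pr.d = f := by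
  let pr' := ((MinPres.ofFGP hP).prod pr).congr e.symm
  obtain ⟨k, hk⟩ := pr'.exists_factor_of_hom_tau (hM pr') (f.comp (LinearMap.snd R _ _))
  refine ⟨k.comp (LinearMap.inr R _ _), LinearMap.ext fun x => ?_⟩
  exact LinearMap.congr_fun hk (0, x)

end

section
variable {R S : Type u} [Ring R] [Ring S] {σ : AntiIso R S}
variable {A T P Q : Type u} [AddCommGroup A] [Module R A] [AddCommGroup T] [Module S T]
  [AddCommGroup P] [Module R P] [AddCommGroup Q] [Module S Q]

namespace TrData

lemma hom_eq_zero (X : TrData σ A T) (D : DualPair σ P Q)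
    (h : ∀ f : X.pr.P₁ →ₗ[R] P, ∃ k : X.pr.P₀ →ₗ[R] P, k.comp X.pr.d = f) (g : Q →ₗ[S] T) :
    g = 0 := by
  obtain ⟨g', hg'⟩ := exists_lift D.fgpQ.2 X.pr'.p X.pr'.surj g
  obtain ⟨f, hf⟩ := DualPair.exists_adj' X.D1 D g'
  obtain ⟨k, rfl⟩ := h f
  obtain ⟨k', hk'⟩ := DualPair.exists_adj X.D0 D k
  refine LinearMap.ext fun q => ?_
  rw [← hg', hf.unique (X.adj.comp hk') q]
  exact X.pr'.p_d _

lemma exists_factor_proj (X : TrData σ A T) (D : DualPair σ P Q)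
    (h : ∀ f : P →ₗ[R] A, f = 0) (f : X.pr'.P₁ →ₗ[S] Q) :
    ∃ k : X.pr'.P₀ →ₗ[S] Q, k.comp X.pr'.d = f := by
  obtain ⟨f', hf'⟩ := DualPair.exists_adj' D X.D0 f
  obtain ⟨g, hg⟩ := exists_lift D.fgpP.2 X.pr.d.rangeRestrict X.pr.d.surjective_rangeRestrict
    (f'.codRestrict (LinearMap.range X.pr.d) fun x =>
      (X.pr.exact _).1 (LinearMap.congr_fun (h (X.pr.p.comp f')) x))
  have hg' : X.pr.d.comp g = f' := LinearMap.ext fun x => congrArg Subtype.val (hg x)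
  obtain ⟨k, hk⟩ := DualPair.exists_adj D X.D1 g
  subst hg'
  exact ⟨k, LinearMap.ext fun q => (hk.comp X.adj).unique hf' q⟩

lemma exists_factor_tr (X : TrData σ A T)
    (h : ∀ f : X.pr.P₁ →ₗ[R] A, ∃ k : X.pr.P₀ →ₗ[R] A, k.comp X.pr.d = f) (f : X.pr'.P₁ →ₗ[S] T) :
    ∃ k : X.pr'.P₀ →ₗ[S] T, k.comp X.pr'.d = f := by
  obtain ⟨θ, hθ⟩ := exists_lift X.pr'.fgp₁.2 X.pr'.p X.pr'.surj f
  obtain ⟨θ', hθ'⟩ := DualPair.exists_adj' X.D1 X.D0 θ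
  obtain ⟨k, hk⟩ := h (X.pr.p.comp θ')
  obtain ⟨k', hk'⟩ := exists_lift X.pr.fgp₀.2 X.pr.p X.pr.surj k
  have hd : ∀ x, X.pr.p ((θ' - k'.comp X.pr.d) x) = 0 := fun x => by
    rw [LinearMap.sub_apply, map_sub, LinearMap.comp_apply, hk', sub_eq_zero]
    exact (LinearMap.congr_fun hk x).symm
  obtain ⟨g, hg⟩ := exists_lift X.pr.fgp₁.2 X.pr.d.rangeRestrict X.pr.d.surjective_rangeRestrict
    ((θ' - k'.comp X.pr.d).codRestrict (LinearMap.range X.pr.d) fun x => (X.pr.exact _).1 (hd x))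
  have hg' : ∀ x, X.pr.d (g x) = θ' x - k' (X.pr.d x) := fun x => congrArg Subtype.val (hg x)
  obtain ⟨κ, hκ⟩ := DualPair.exists_adj X.D0 X.D0 k'
  obtain ⟨γ, hγ⟩ := DualPair.exists_adj X.D1 X.D1 g
  have key : ∀ q, θ q = X.pr'.d (κ q) + γ (X.pr'.d q) := fun q => X.D1.ext_right fun p => by
    rw [X.D1.add_right, hθ', X.adj, hκ, hγ, X.adj, hg', X.D0.sub_left, add_sub_cancel]
  refine ⟨X.pr'.p.comp γ, LinearMap.ext fun q => ?_⟩
  rw [← hθ, key, map_add, X.pr'.p_d, zero_add]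
  rfl

end TrData
end

section
variable {R : Type u} [Ring R]

/-- `A` is a submodule of a finitely generated projective module with quotient `B`, and every
functional on `A` extends to that projective module. -/
def IsGPStep (R : Type u) [Ring R] (A B : Type u) [AddCommGroup A] [Module R A]
    [AddCommGroup B] [Module R B] : Prop :=
  ∃ (P : Type u) (_ : AddCommGroup P) (_ : Module R P) (i : A →ₗ[R] P) (q : P →ₗ[R] B),
    FGP R P ∧ Injective i ∧ Surjective q ∧ Exact i q ∧ ∀ f : A →ₗ[R] R, ∃ g : P →ₗ[R] R, g.comp i = f

variable {A B A' B' : Type u} [AddCommGroup A] [Module R A] [AddCommGroup B] [Module R B]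
  [AddCommGroup A'] [Module R A'] [AddCommGroup B'] [Module R B']

lemma IsGPStep.congr (h : IsGPStep R A B) (e : A ≃ₗ[R] A') (e' : B ≃ₗ[R] B') :
    IsGPStep R A' B' := by
  obtain ⟨P, _, _, i, q, hP, hi, hq, hiq, hext⟩ := h
  refine ⟨P, _, _, i.comp e.symm.toLinearMap, e'.toLinearMap.comp q, hP, ?_, ?_, fun x => ?_,
    fun f => ?_⟩
  · exact hi.comp e.symm.injective
  · exact e'.surjective.comp hq
  · change e' (q x) = 0 ↔ _
    rw [e'.map_eq_zero_iff, hiq]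
    exact (e.symm.surjective.range_comp i).symm ▸ Iff.rfl
  · obtain ⟨g, hg⟩ := hext (f.comp e.toLinearMap)
    refine ⟨g, LinearMap.ext fun x => ?_⟩
    simpa using LinearMap.congr_fun hg (e.symm x)

lemma IsGP.congr (h : IsGP R A) (e : A ≃ₗ[R] A') : IsGP R A' := by
  obtain ⟨P, i1, i2, d, h1, h2, h3, h4, ⟨f⟩⟩ := h
  exact ⟨P, i1, i2, d, h1, h2, h3, h4, ⟨e.symm.trans f⟩⟩

lemma IsGP.exists_chain (h : IsGP R A) : ∃ X : ℤ → ModuleCat.{u} R,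
    (∀ n, IsGPStep R (X n) (X (n + 1))) ∧ Nonempty (A ≃ₗ[R] X (-1)) := by
  obtain ⟨P, _, _, d, h1, h2, h3, h4, hf⟩ := h
  refine ⟨fun n => .of R (LinearMap.range (d n)), fun n => ?_, hf⟩
  refine ⟨P (n + 1), _, _, (LinearMap.range (d n)).subtype, (d (n + 1)).rangeRestrict,
    ⟨h1 _, h2 _⟩, Subtype.val_injective, (d (n + 1)).surjective_rangeRestrict, fun x => ?_,
    fun f => ?_⟩
  · have h5 := h3 n x
    rw [← Subtype.coe_inj]
    change d (n + 1) x = 0 ↔ _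
    rw [h5]
    simp
  · obtain ⟨n, rfl⟩ : ∃ m, n = m + 1 := ⟨n - 1, by omega⟩
    obtain ⟨g, hg⟩ := (h4 n (f.comp (d (n + 1)).rangeRestrict)).1 (LinearMap.ext fun x => by
      have h5 : (d (n + 1)).rangeRestrict (d n x) = 0 := Subtype.ext ((h3 n _).2 ⟨x, rfl⟩)
      change f ((d (n + 1)).rangeRestrict (d n x)) = 0
      rw [h5, map_zero])
    refine ⟨g, LinearMap.ext fun x => ?_⟩
    obtain ⟨y, rfl⟩ := (d (n + 1)).surjective_rangeRestrict x
    exact LinearMap.congr_fun hg y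

lemma isGP_of_chain (X : ℤ → ModuleCat.{u} R) (h : ∀ n, IsGPStep R (X n) (X (n + 1)))
    (e : A ≃ₗ[R] X (-1 + 1)) : IsGP R A := by
  choose P i1 i2 i q hP hi hq hiq hext using h
  have hz : ∀ n x, q n (i n x) = 0 := fun n x => (hiq n _).2 ⟨x, rfl⟩
  let d : ∀ n, P n →ₗ[R] P (n + 1) := fun n => LinearMap.comp (i (n + 1)) (q n)
  let e2 : X (-1 + 1) ≃ₗ[R] LinearMap.range (d (-1)) :=
    (LinearEquiv.ofInjective (i (-1 + 1)) (hi _)).trans (LinearEquiv.ofEq _ _ (by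
      rw [LinearMap.range_comp, LinearMap.range_eq_top.2 (hq _), Submodule.map_top]))
  refine ⟨P, i1, i2, d, fun n => (hP n).1, fun n => (hP n).2,
    fun n x => ?_, fun n g => ⟨fun hg => ?_, ?_⟩, ⟨e.trans e2⟩⟩
  · constructor
    · intro hx
      obtain ⟨y, rfl⟩ := (hiq _ _).1 ((map_eq_zero_iff _ (hi _)).1 hx)
      obtain ⟨z, rfl⟩ := hq _ y
      exact ⟨z, rfl⟩
    · rintro ⟨y, rfl⟩
      change i (n + 1 + 1) (q (n + 1) (i (n + 1) (q n y))) = 0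
      rw [hz, map_zero]
  · obtain ⟨k, hk⟩ := exists_factor (q (n + 1)) (hq _) g fun x hx => by
      obtain ⟨y, rfl⟩ := (hiq _ _).1 hx
      obtain ⟨z, rfl⟩ := hq _ y
      exact LinearMap.congr_fun hg z
    obtain ⟨k', rfl⟩ := hext _ k
    exact ⟨k', LinearMap.ext hk⟩
  · rintro ⟨k, rfl⟩
    refine LinearMap.ext fun x => ?_
    change k (i (n + 1 + 1) (q (n + 1) (i (n + 1) (q n x)))) = 0
    rw [hz, map_zero, map_zero]

/-- A class of modules closed under steps in both directions consists of Gorenstein projectives. -/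
lemma isGP_of_class (C : ModuleCat.{u} R → Prop) (up : ∀ X, C X → ∃ Y, C Y ∧ IsGPStep R X Y)
    (down : ∀ Y, C Y → ∃ X, C X ∧ IsGPStep R X Y) (h : C (.of R A)) : IsGP R A := by
  choose u hu hu' using fun X : {X // C X} => up X.1 X.2
  choose v hv hv' using fun X : {X // C X} => down X.1 X.2
  let U : {X // C X} → {X // C X} := fun X => ⟨u X, hu X⟩
  let V : {X // C X} → {X // C X} := fun X => ⟨v X, hv X⟩
  let X : ℤ → {X // C X} := fun n => match n with
    | .ofNat n => U^[n] ⟨_, h⟩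
    | .negSucc n => V^[n + 1] ⟨_, h⟩
  have key : ∀ n, IsGPStep R (X n).1 (X (n + 1)).1 := fun n => match n with
    | .ofNat n => by
      change IsGPStep R (U^[n] ⟨_, h⟩).1 (U^[n + 1] ⟨_, h⟩).1
      rw [iterate_succ_apply']
      exact hu' _
    | .negSucc 0 => hv' _
    | .negSucc (n + 1) => by
      change IsGPStep R (V^[n + 1 + 1] ⟨_, h⟩).1 (V^[n + 1] ⟨_, h⟩).1
      rw [iterate_succ_apply']
      exact hv' _
  exact isGP_of_chain (fun n => (X n).1) key (LinearEquiv.refl R A)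

lemma isGP_chain (X : ℤ → ModuleCat.{u} R) (h : ∀ n, IsGPStep R (X n) (X (n + 1))) (n : ℤ) :
    IsGP R (X n) :=
  isGP_of_class (fun Y => ∃ n, Nonempty (Y ≃ₗ[R] X n))
    (fun _ ⟨n, ⟨e⟩⟩ => ⟨X (n + 1), ⟨n + 1, ⟨LinearEquiv.refl R _⟩⟩,
      (h n).congr e.symm (LinearEquiv.refl R _)⟩)
    (fun _ ⟨n, ⟨e⟩⟩ => ⟨X (n - 1), ⟨n - 1, ⟨LinearEquiv.refl R _⟩⟩, by
      have h1 := h (n - 1)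
      rw [sub_add_cancel] at h1
      exact h1.congr (LinearEquiv.refl R _) e.symm⟩) ⟨n, ⟨LinearEquiv.refl R _⟩⟩

lemma IsGP.exists_up (h : IsGP R A) : ∃ X : ModuleCat.{u} R, IsGP R X ∧ IsGPStep R A X := by
  obtain ⟨X, hX, ⟨e⟩⟩ := h.exists_chain
  exact ⟨X (-1 + 1), isGP_chain X hX _, (hX _).congr e.symm (LinearEquiv.refl R _)⟩

lemma IsGP.exists_down (h : IsGP R A) : ∃ X : ModuleCat.{u} R, IsGP R X ∧ IsGPStep R X A := by
  obtain ⟨X, hX, ⟨e⟩⟩ := h.exists_chain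
  have h1 := hX (-1 - 1)
  rw [sub_add_cancel] at h1
  exact ⟨X (-1 - 1), isGP_chain X hX _, h1.congr (LinearEquiv.refl R _) e.symm⟩

end

section
variable {R : Type u} [Ring R]
variable {A B L P Q : Type u} [AddCommGroup A] [Module R A] [AddCommGroup B] [Module R B]
  [AddCommGroup L] [Module R L] [AddCommGroup P] [Module R P] [AddCommGroup Q] [Module R Q]

/-- The product of a module with the zero module. -/
def prodPUnit (R : Type u) [Ring R] (B : Type u) [AddCommGroup B] [Module R B] :
    B ≃ₗ[R] B × PUnit.{u + 1} where
  toFun b := (b, 0)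
  map_add' _ _ := rfl
  map_smul' _ _ := rfl
  invFun b := b.1
  left_inv _ := rfl
  right_inv _ := rfl

lemma IsGPStep.prod_left (h : IsGPStep R A B) (hQ : FGP R Q) : IsGPStep R (A × Q) B := by
  obtain ⟨P, _, _, i, q, hP, hi, hq, hiq, hext⟩ := h
  refine ⟨P × Q, _, _, i.prodMap LinearMap.id, q.comp (LinearMap.fst R P Q), hP.prod hQ,
    fun x y hxy => ?_, hq.comp Prod.fst_surjective, fun x => ?_, fun f => ?_⟩
  · have h1 : i x.1 = i y.1 := (Prod.ext_iff.1 hxy).1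
    have h2 : x.2 = y.2 := (Prod.ext_iff.1 hxy).2
    exact Prod.ext (hi h1) h2
  · refine (hiq x.1).trans ⟨?_, ?_⟩
    · rintro ⟨a, ha⟩
      exact ⟨(a, x.2), Prod.ext ha rfl⟩
    · rintro ⟨a, rfl⟩
      exact ⟨a.1, rfl⟩
  · obtain ⟨g, hg⟩ := hext (f.comp (LinearMap.inl R A Q))
    refine ⟨g.coprod (f.comp (LinearMap.inr R A Q)), LinearMap.ext fun x => ?_⟩
    have h1 : g (i x.1) = f (x.1, 0) := LinearMap.congr_fun hg x.1
    change g (i x.1) + f (0, x.2) = f x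
    rw [h1, ← map_add]
    simp

lemma IsGPStep.prod_right (h : IsGPStep R A B) (hQ : FGP R Q) : IsGPStep R A (B × Q) := by
  obtain ⟨P, _, _, i, q, hP, hi, hq, hiq, hext⟩ := h
  refine ⟨P × Q, _, _, (LinearMap.inl R P Q).comp i, q.prodMap LinearMap.id, hP.prod hQ,
    fun x y hxy => ?_, fun x => ?_, fun x => ?_, fun f => ?_⟩
  · exact hi (congrArg Prod.fst hxy)
  · obtain ⟨p, hp⟩ := hq x.1
    exact ⟨(p, x.2), Prod.ext hp rfl⟩
  · constructor
    · intro hx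
      obtain ⟨a, ha⟩ := (hiq x.1).1 (congrArg Prod.fst hx)
      exact ⟨a, Prod.ext ha (congrArg Prod.snd hx).symm⟩
    · rintro ⟨a, rfl⟩
      exact Prod.ext ((hiq _).2 ⟨a, rfl⟩) rfl
  · obtain ⟨g, hg⟩ := hext f
    refine ⟨g.comp (LinearMap.fst R P Q), hg⟩

lemma IsGP.prod (h : IsGP R A) (hQ : FGP R Q) : IsGP R (A × Q) := by
  refine isGP_of_class (fun Y => ∃ (A Q : ModuleCat.{u} R), IsGP R A ∧ FGP R Q ∧
    Nonempty (Y ≃ₗ[R] A × Q)) ?_ ?_ ⟨.of R A, .of R Q, h, hQ, ⟨LinearEquiv.refl R _⟩⟩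
  · rintro X ⟨A, Q, hA, hQ, ⟨e⟩⟩
    obtain ⟨B, hB, hs⟩ := hA.exists_up
    exact ⟨B, ⟨B, .of R PUnit.{u + 1}, hB, FGP.of_subsingleton, ⟨prodPUnit R B⟩⟩,
      (hs.prod_left hQ).congr e.symm (LinearEquiv.refl R _)⟩
  · rintro X ⟨A, Q, hA, hQ, ⟨e⟩⟩
    obtain ⟨B, hB, hs⟩ := hA.exists_down
    exact ⟨B, ⟨B, .of R PUnit.{u + 1}, hB, FGP.of_subsingleton, ⟨prodPUnit R B⟩⟩,
      (hs.prod_right hQ).congr (LinearEquiv.refl R _) e.symm⟩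

lemma FGP.ker (hP : FGP R P) (hQ : FGP R Q) (f : P →ₗ[R] Q) (hf : Surjective f) :
    FGP R (LinearMap.ker f) := by
  obtain ⟨s, hs⟩ := exists_lift hQ.2 f hf LinearMap.id
  obtain ⟨r, hr⟩ := exists_cofactor (LinearMap.ker f).subtype Subtype.val_injective
    (LinearMap.id - s.comp f) fun p => ⟨⟨p - s (f p), by simp [hs]⟩, rfl⟩
  refine hP.of_retract (LinearMap.ker f).subtype r fun x => Subtype.ext ?_
  have h1 : f x.1 = 0 := x.2
  refine (hr x.1).trans ?_
  simp [h1]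

/-- If every functional extends along a map, so does every map to a finitely generated
projective module. -/
lemma FGP.exists_extension (hQ : FGP R Q) (i : A →ₗ[R] P)
    (h : ∀ f : A →ₗ[R] R, ∃ g : P →ₗ[R] R, g.comp i = f) (f : A →ₗ[R] Q) :
    ∃ g : P →ₗ[R] Q, g.comp i = f := by
  obtain ⟨n, α, v, hv⟩ := hQ.dual_basis
  choose g hg using fun j => h ((α j).comp f)
  refine ⟨∑ j, (g j).smulRight (v j), LinearMap.ext fun a => ?_⟩
  rw [LinearMap.comp_apply, LinearMap.sum_apply, ← hv (f a)]
  exact Finset.sum_congr rfl fun j _ => congrArg (· • v j) (LinearMap.congr_fun (hg j) a)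

lemma IsGPStep.of_prod_left (h : IsGPStep R (A × Q) B) (hQ : FGP R Q) : IsGPStep R A B := by
  obtain ⟨P, _, _, i, q, hP, hi, hq, hiq, hext⟩ := h
  obtain ⟨π, hπ⟩ := hQ.exists_extension i hext (LinearMap.snd R A Q)
  have hπ' : ∀ a y, π (i (a, y)) = y := fun a y => LinearMap.congr_fun hπ (a, y)
  have hπs : Surjective π := fun y => ⟨_, hπ' 0 y⟩
  refine ⟨LinearMap.ker π, _, _, (i.comp (LinearMap.inl R A Q)).codRestrict _ fun a => hπ' a 0,
    q.comp (Submodule.subtype _), hP.ker hQ π hπs, fun x y hxy => ?_, fun b => ?_, fun x => ?_,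
    fun f => ?_⟩
  · exact congrArg Prod.fst (hi (congrArg Subtype.val hxy))
  · obtain ⟨p, rfl⟩ := hq b
    refine ⟨⟨p - i (0, π p), by simp [hπ']⟩, ?_⟩
    change q (p - i (0, π p)) = q p
    rw [map_sub, (hiq _).2 ⟨_, rfl⟩, sub_zero]
  · constructor
    · intro hx
      obtain ⟨⟨a, y⟩, ha⟩ := (hiq x.1).1 hx
      have hy : y = 0 := by
        rw [← hπ' a y, ha]
        exact x.2
      subst hy
      exact ⟨a, Subtype.ext ha⟩
    · rintro ⟨a, rfl⟩
      exact (hiq _).2 ⟨_, rfl⟩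
  · obtain ⟨g, hg⟩ := hext (f.comp (LinearMap.fst R A Q))
    exact ⟨g.comp (Submodule.subtype _), LinearMap.ext fun a => LinearMap.congr_fun hg (a, 0)⟩

lemma IsGPStep.of_prod_right (h : IsGPStep R A (B × Q)) (hQ : FGP R Q) : IsGPStep R A B := by
  obtain ⟨P, _, _, i, q, hP, hi, hq, hiq, hext⟩ := h
  let π : P →ₗ[R] Q := (LinearMap.snd R B Q).comp q
  have hπs : Surjective π := Prod.snd_surjective.comp hq
  have hqi : ∀ a, q (i a) = 0 := fun a => (hiq _).2 ⟨a, rfl⟩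
  refine ⟨LinearMap.ker π, _, _, i.codRestrict _ fun a => congrArg Prod.snd (hqi a),
    ((LinearMap.fst R B Q).comp q).comp (Submodule.subtype _), hP.ker hQ π hπs,
    fun x y hxy => ?_, fun b => ?_, fun x => ?_, fun f => ?_⟩
  · exact hi (congrArg Subtype.val hxy)
  · obtain ⟨p, hp⟩ := hq (b, 0)
    exact ⟨⟨p, congrArg Prod.snd hp⟩, congrArg Prod.fst hp⟩
  · constructor
    · intro hx
      obtain ⟨a, ha⟩ := (hiq x.1).1 (Prod.ext hx x.2)
      exact ⟨a, Subtype.ext ha⟩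
    · rintro ⟨a, rfl⟩
      exact congrArg Prod.fst (hqi a)
  · obtain ⟨g, hg⟩ := hext f
    exact ⟨g.comp (Submodule.subtype _), hg⟩

lemma IsGP.of_prod (h : IsGP R (A × Q)) (hQ : FGP R Q) : IsGP R A := by
  refine isGP_of_class (fun Y => ∃ (Q : ModuleCat.{u} R), FGP R Q ∧ IsGP R (Y × Q)) ?_ ?_
    ⟨.of R Q, hQ, h⟩
  · rintro X ⟨Q, hQ, hX⟩
    obtain ⟨B, hB, hs⟩ := hX.exists_up
    exact ⟨B, ⟨.of R PUnit.{u + 1}, FGP.of_subsingleton, hB.congr (prodPUnit R B)⟩,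
      hs.of_prod_left hQ⟩
  · rintro X ⟨Q, hQ, hX⟩
    obtain ⟨B, hB, hs⟩ := hX.exists_down
    exact ⟨B, ⟨.of R PUnit.{u + 1}, FGP.of_subsingleton, hB.congr (prodPUnit R B)⟩,
      hs.of_prod_right hQ⟩

/-- Functionals extend along inclusions with Gorenstein projective cokernel. -/
lemma IsGP.exists_extension (h : IsGP R A) (i : L →ₗ[R] B) (p : B →ₗ[R] A) (hi : Injective i)
    (hp : Surjective p) (hip : Exact i p) (f : L →ₗ[R] R) : ∃ g : B →ₗ[R] R, g.comp i = f := by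
  obtain ⟨X, -, P, _, _, j, q, hP, hj, hq, hjq, hext⟩ := h.exists_down
  obtain ⟨a, ha⟩ := exists_lift hP.2 p hp q
  obtain ⟨b, hb⟩ := exists_cofactor i hi (a.comp j) fun x =>
    (hip _).1 (by rw [LinearMap.comp_apply, ha]; exact (hjq _).2 ⟨x, rfl⟩)
  obtain ⟨k, hk⟩ := hext (f.comp b)
  have hk' : ∀ x, k (j x) = f (b x) := fun x => LinearMap.congr_fun hk x
  obtain ⟨g, hg⟩ := exists_factor (i.coprod a) (fun y => by
    obtain ⟨z, hz⟩ := hq (p y)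
    obtain ⟨x, hx⟩ := (hip (y - a z)).1 (by rw [map_sub, ha, hz, sub_self])
    exact ⟨(x, z), by simp [hx]⟩) (f.coprod k) fun x hx => by
    have h1 : i x.1 + a x.2 = 0 := hx
    have h2 : q x.2 = 0 := by
      have := congrArg p h1
      rwa [map_add, (hip _).2 ⟨_, rfl⟩, ha, zero_add, map_zero] at this
    obtain ⟨y, hy⟩ := (hjq _).1 h2
    have h3 : i (x.1 + b y) = 0 := by
      rw [map_add, hb, LinearMap.comp_apply, hy, h1]
    have h4 : x.1 + b y = 0 := (map_eq_zero_iff _ hi).1 h3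
    change f x.1 + k x.2 = 0
    rw [← hy, hk', ← map_add, h4, map_zero]
  exact ⟨g, LinearMap.ext fun x => by simpa using hg (x, 0)⟩

/-- Schanuel's lemma. -/
lemma schanuel {P' L' : Type u} [AddCommGroup P'] [Module R P'] [AddCommGroup L'] [Module R L']
    (hP : Module.Projective R P) (hP' : Module.Projective R P') (i : L →ₗ[R] P) (p : P →ₗ[R] A)
    (i' : L' →ₗ[R] P') (p' : P' →ₗ[R] A) (hi : Injective i) (hi' : Injective i')
    (hp : Surjective p) (hp' : Surjective p') (h : Exact i p) (h' : Exact i' p') :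
    Nonempty ((L × P') ≃ₗ[R] L' × P) := by
  obtain ⟨a, ha⟩ := exists_lift hP p' hp' p
  obtain ⟨b, hb⟩ := exists_lift hP' p hp p'
  have hz : ∀ x, p (i x) = 0 := fun x => (h _).2 ⟨x, rfl⟩
  have hz' : ∀ x, p' (i' x) = 0 := fun x => (h' _).2 ⟨x, rfl⟩
  let t : (L × P') →ₗ[R] P := i.coprod (-b)
  have ht : ∀ x y, t (x, y) = i x - b y := fun x y => by simp [t, sub_eq_add_neg]
  let s : (L × P') →ₗ[R] P' := a.comp t + LinearMap.snd R L P'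
  have hs : ∀ x, s x = a (t x) + x.2 := fun x => rfl
  obtain ⟨k, hk⟩ := exists_cofactor i' hi' s fun x => (h' _).1 (by
    rw [hs, map_add, ha, ← Prod.mk.eta (p := x), ht, map_sub, hz, hb]
    simp)
  refine ⟨LinearEquiv.ofBijective (k.prod t) ⟨(injective_iff_map_eq_zero _).2 fun x hx => ?_,
    fun y => ?_⟩⟩
  · have h1 : k x = 0 := congrArg Prod.fst hx
    have h2 : t x = 0 := congrArg Prod.snd hx
    have h3 := hk x
    rw [h1, hs, h2, map_zero, map_zero, zero_add] at h3
    rw [← Prod.mk.eta (p := x), ← h3, ht, map_zero, sub_zero] at h2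
    exact Prod.ext ((map_eq_zero_iff _ hi).1 h2) h3.symm
  · obtain ⟨x, hx⟩ := (h (y.2 + b (i' y.1 - a y.2))).1 (by
      rw [map_add, hb, map_sub, hz', ha]
      simp)
    have h1 : t (x, i' y.1 - a y.2) = y.2 := by rw [ht, hx, add_sub_cancel_right]
    refine ⟨(x, i' y.1 - a y.2), Prod.ext (hi' ?_) h1⟩
    refine (hk _).trans ?_
    rw [hs, h1, add_sub_cancel]

lemma IsGP.kernel (h : IsGP R A) (hP : FGP R P) (i : L →ₗ[R] P) (p : P →ₗ[R] A) (hi : Injective i)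
    (hp : Surjective p) (hip : Exact i p) : IsGP R L := by
  obtain ⟨X, hX, P', _, _, j, q, hP', hj, hq, hjq, -⟩ := h.exists_down
  obtain ⟨e⟩ := schanuel hP.2 hP'.2 i p j q hi hj hp hq hip hjq
  exact ((hX.prod hP).congr e.symm).of_prod hP'

end

section
variable {R S : Type u} [Ring R] [Ring S] {σ : AntiIso R S}
variable {A B T : Type u} [AddCommGroup A] [Module R A] [AddCommGroup B] [Module R B]
  [AddCommGroup T] [Module S T]

/-- Restriction of functionals along a linear map. -/
def Dual.map (σ : AntiIso R S) (f : A →ₗ[R] B) : Dual σ B →ₗ[S] Dual σ A where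
  toFun g := (g.ev.comp f : A →ₗ[R] R)
  map_add' _ _ := rfl
  map_smul' _ _ := rfl

/-- A functional as an element of the dual module. -/
def Dual.mk (σ : AntiIso R S) (f : A →ₗ[R] R) : Dual σ A := f

lemma IsGP.eq_zero_of_forall_functional (h : IsGP R A) (a : A) (ha : ∀ f : A →ₗ[R] R, f a = 0) :
    a = 0 := by
  obtain ⟨X, -, P, _, _, i, q, hP, hi, -, -, -⟩ := h.exists_up
  refine hi ?_
  rw [map_zero]
  obtain ⟨n, α, v, hv⟩ := hP.dual_basis
  rw [← hv (i a)]
  exact Finset.sum_eq_zero fun j _ => by rw [show α j (i a) = 0 from ha ((α j).comp i), zero_smul]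

lemma IsGP.exists_eq_eval (h : IsGP R A) (φ : Dual σ A →ₗ[S] S) :
    ∃ a, ∀ f : Dual σ A, φ f = σ.e (f.ev a) := by
  obtain ⟨X, hX, P, _, _, i, q, hP, hi, hq, hiq, hext⟩ := h.exists_up
  obtain ⟨D, hD⟩ := hP.exists_dualPair_dual σ
  obtain ⟨p, hp⟩ := D.right (φ.comp (Dual.map σ i))
  have hqp : q p = 0 := hX.eq_zero_of_forall_functional _ fun g => by
    have h1 : Dual.map σ i (Dual.mk σ (g.comp q)) = 0 := Dual.ext_ev σ fun a => by
      change g (q (i a)) = 0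
      rw [(hiq _).2 ⟨a, rfl⟩, map_zero]
    have h2 := hp (Dual.mk σ (g.comp q))
    rw [hD, LinearMap.comp_apply, h1, map_zero] at h2
    exact σ.e.injective (h2.trans (map_zero σ.e).symm)
  obtain ⟨a, rfl⟩ := (hiq p).1 hqp
  refine ⟨a, fun f => ?_⟩
  obtain ⟨g, hg⟩ := hext f.ev
  have h1 := hp (Dual.mk σ g)
  have h2 : Dual.map σ i (Dual.mk σ g) = f := hg
  rw [hD, LinearMap.comp_apply, h2] at h1
  rw [← h1, ← h2]
  rfl

lemma IsGPStep.dual (h : IsGPStep R A B) (hB : IsGP R B) :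
    IsGPStep S (Dual σ B) (Dual σ A) := by
  obtain ⟨P, _, _, i, q, hP, hi, hq, hiq, hext⟩ := h
  obtain ⟨D, hD⟩ := hP.exists_dualPair_dual σ
  refine ⟨Dual σ P, _, _, Dual.map σ q, Dual.map σ i, D.fgpQ, fun f g hfg => ?_, fun f => ?_,
    fun f => ⟨fun hf => ?_, ?_⟩, fun φ => ?_⟩
  · refine Dual.ext_ev σ fun b => ?_
    obtain ⟨x, rfl⟩ := hq b
    exact LinearMap.congr_fun (congrArg Dual.ev hfg) x
  · obtain ⟨g, hg⟩ := hext f.ev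
    exact ⟨Dual.mk σ g, hg⟩
  · obtain ⟨k, hk⟩ := exists_factor q hq f.ev fun x hx => by
      obtain ⟨a, rfl⟩ := (hiq _).1 hx
      exact LinearMap.congr_fun (congrArg Dual.ev hf) a
    exact ⟨Dual.mk σ k, LinearMap.ext hk⟩
  · rintro ⟨g, rfl⟩
    refine Dual.ext_ev σ fun a => ?_
    change g.ev (q (i a)) = 0
    rw [(hiq _).2 ⟨a, rfl⟩, map_zero]
  · obtain ⟨b, hb⟩ := hB.exists_eq_eval φ
    obtain ⟨x, rfl⟩ := hq b
    refine ⟨D.swap.mapL x, LinearMap.ext fun f => ?_⟩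
    rw [hb]
    exact congrArg σ.e (hD _ _)

lemma IsGP.dual (h : IsGP R A) : IsGP S (Dual σ A) := by
  refine isGP_of_class (fun Y => ∃ A : ModuleCat.{u} R, IsGP R A ∧ Nonempty (Y ≃ₗ[S] Dual σ A))
    ?_ ?_ ⟨.of R A, h, ⟨LinearEquiv.refl S _⟩⟩
  · rintro Y ⟨A, hA, ⟨e⟩⟩
    obtain ⟨B, hB, hs⟩ := hA.exists_down
    exact ⟨.of S (Dual σ B), ⟨B, hB, ⟨LinearEquiv.refl S _⟩⟩,
      (hs.dual hA).congr e.symm (LinearEquiv.refl S _)⟩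
  · rintro Y ⟨A, hA, ⟨e⟩⟩
    obtain ⟨B, hB, hs⟩ := hA.exists_up
    exact ⟨.of S (Dual σ B), ⟨B, hB, ⟨LinearEquiv.refl S _⟩⟩,
      (hs.dual hB).congr (LinearEquiv.refl S _) e.symm⟩

lemma TrData.isGP (X : TrData σ A T) (hA : IsGP R A) : IsGP S T := by
  let Ω := LinearMap.range X.pr.d
  have hΩ : IsGP R Ω := hA.kernel X.pr.fgp₀ Ω.subtype X.pr.p Subtype.val_injective X.pr.surj
    fun x => (X.pr.exact x).trans (by simp [Ω])
  let L := LinearMap.ker X.pr.d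
  have hLex : Exact L.subtype X.pr.d.rangeRestrict := fun x => by
    rw [← LinearMap.mem_ker, LinearMap.ker_rangeRestrict]
    simp [L]
  have hL : IsGP R L := hΩ.kernel X.pr.fgp₁ L.subtype X.pr.d.rangeRestrict Subtype.val_injective
    X.pr.d.surjective_rangeRestrict hLex
  let ρ : X.pr'.P₀ →ₗ[S] Dual σ L :=
    { toFun := fun q => Dual.mk σ ((X.D1.mapL q).comp L.subtype)
      map_add' := fun a b => Dual.ext_ev σ fun x => X.D1.add_right _ _ _
      map_smul' := fun s a => Dual.ext_ev σ fun x => X.D1.smul_right _ _ _ }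
  have hρs : Surjective ρ := fun f => by
    obtain ⟨g, hg⟩ := hΩ.exists_extension L.subtype X.pr.d.rangeRestrict Subtype.val_injective
      X.pr.d.surjective_rangeRestrict hLex f.ev
    obtain ⟨q, hq⟩ := X.D1.left g
    refine ⟨q, Dual.ext_ev σ fun x => ?_⟩
    rw [← hg]
    exact hq _
  have hρk : ∀ q, ρ q = 0 ↔ X.pr'.p q = 0 := fun q => by
    rw [X.pr'.exact q]
    constructor
    · intro h
      obtain ⟨k, hk⟩ := exists_factor X.pr.d.rangeRestrict X.pr.d.surjective_rangeRestrict
        (X.D1.mapL q) fun x hx => by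
          obtain ⟨y, rfl⟩ := (hLex x).1 hx
          exact LinearMap.congr_fun (congrArg Dual.ev h) y
      obtain ⟨g, hg⟩ := hA.exists_extension Ω.subtype X.pr.p Subtype.val_injective X.pr.surj
        (fun x => (X.pr.exact x).trans (by simp [Ω])) k
      obtain ⟨z, hz⟩ := X.D0.left g
      refine ⟨z, X.D1.ext_right fun x => ?_⟩
      rw [X.adj, hz]
      exact (LinearMap.congr_fun hg _).trans (hk x)
    · rintro ⟨z, rfl⟩
      refine Dual.ext_ev σ fun x => (X.adj x.1 z).trans ?_
      rw [show X.pr.d x.1 = 0 from x.2, X.D0.zero_left]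
      rfl
  obtain ⟨k, hk⟩ := exists_factor ρ hρs X.pr'.p fun q hq => (hρk q).1 hq
  refine (hL.dual (σ := σ)).congr (LinearEquiv.ofBijective k
    ⟨(injective_iff_map_eq_zero _).2 fun f hf => ?_, fun t => ?_⟩)
  · obtain ⟨q, rfl⟩ := hρs f
    exact (hρk q).2 (by rw [← hk, hf])
  · obtain ⟨q, rfl⟩ := X.pr'.surj t
    exact ⟨ρ q, hk q⟩

end

section
variable {R S : Type u} [Ring R] [Ring S]

/-- `(N, Q)` is the dagger of `(M, P)` with respect to the anti-isomorphism `σ`: there is a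
splitting `M ≅ Mp ⊕ A` with `Mp` projective such that `N` is the sum of the dual of `P` and the
transpose of `A`, and `Q` is the dual of `Mp`. -/
def Dag (σ : AntiIso R S) (M P N Q : Type u) [AddCommGroup M] [Module R M] [AddCommGroup P]
    [Module R P] [AddCommGroup N] [Module S N] [AddCommGroup Q] [Module S Q] : Prop :=
  ∃ (Mp A : ModuleCat.{u} R) (T P' : ModuleCat.{u} S), Nonempty (M ≃ₗ[R] Mp × A) ∧
    Nonempty (N ≃ₗ[S] P' × T) ∧ Nonempty (TrData σ A T) ∧ Nonempty (DualPair σ P P') ∧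
    Nonempty (DualPair σ Mp Q)

variable {σ : AntiIso R S} {M P N Q M' P' N' Q' : Type u} [AddCommGroup M] [Module R M]
  [AddCommGroup P] [Module R P] [AddCommGroup N] [Module S N] [AddCommGroup Q] [Module S Q]
  [AddCommGroup M'] [Module R M'] [AddCommGroup P'] [Module R P'] [AddCommGroup N'] [Module S N']
  [AddCommGroup Q'] [Module S Q']

namespace Dag

lemma symm (h : Dag σ M P N Q) : Dag σ.symm N Q M P := by
  obtain ⟨Mp, A, T, P', e, e', ⟨X⟩, ⟨D⟩, ⟨D'⟩⟩ := h
  exact ⟨P', T, A, Mp, e', e, ⟨X.swap⟩, ⟨D'.swap⟩, ⟨D.swap⟩⟩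

lemma unique [IsArtinianRing R] [IsArtinianRing S] (h : Dag σ M P N Q) (h' : Dag σ M' P' N' Q')
    (e : M ≃ₗ[R] M') (e' : P ≃ₗ[R] P') : Nonempty (N ≃ₗ[S] N') ∧ Nonempty (Q ≃ₗ[S] Q') := by
  obtain ⟨Mp, A, T, P₁, ⟨f⟩, ⟨g⟩, ⟨X⟩, ⟨D⟩, ⟨E⟩⟩ := h
  obtain ⟨Mp', A', T', P₁', ⟨f'⟩, ⟨g'⟩, ⟨X'⟩, ⟨D'⟩, ⟨E'⟩⟩ := h'
  obtain ⟨⟨u⟩, ⟨v⟩⟩ := splitting_unique E.fgpP E'.fgpP X.pr.finite X'.pr.finite X.noProj X'.noProj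
    ((f.symm.trans e).trans f')
  obtain ⟨w⟩ := X.nonempty_equiv X' v
  obtain ⟨z⟩ := D.nonempty_equiv D' e'
  exact ⟨⟨(g.trans (z.prodCongr w)).trans g'.symm⟩, E.nonempty_equiv E' u⟩

lemma isGP (h : Dag σ M P N Q) (hM : IsGP R M) : IsGP S N := by
  obtain ⟨Mp, A, T, P₁, ⟨f⟩, ⟨g⟩, ⟨X⟩, ⟨D⟩, ⟨E⟩⟩ := h
  have hA : IsGP R A := (hM.congr (f.trans (LinearEquiv.prodComm R Mp A))).of_prod E.fgpP
  exact ((X.isGP hA).prod D.fgpQ).congr ((LinearEquiv.prodComm S T P₁).trans g.symm)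

lemma fgp (h : Dag σ M P N Q) : FGP S Q := by
  obtain ⟨Mp, A, T, P₁, -, -, -, -, ⟨E⟩⟩ := h
  exact E.fgpQ

lemma isTauRigidPair (h : Dag σ M P N Q) (K : Type u) [Field K] [Algebra K R] [Algebra K S]
    [Module K M] [IsScalarTower K R M] (hM : IsTauRigid R K M) (hP : ∀ f : P →ₗ[R] M, f = 0) :
    IsTauRigid S K N ∧ ∀ f : Q →ₗ[S] N, f = 0 := by
  obtain ⟨Mp, A, T, P₁, ⟨f⟩, ⟨g⟩, ⟨X⟩, ⟨D⟩, ⟨E⟩⟩ := h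
  have h1 := hM.exists_factor E.fgpP X.pr f
  have hMp : ∀ a : X.pr.P₁ →ₗ[R] Mp, ∃ k : X.pr.P₀ →ₗ[R] Mp, k.comp X.pr.d = a := fun a => by
    obtain ⟨k, hk⟩ := h1 (f.symm.toLinearMap.comp ((LinearMap.inl R Mp A).comp a))
    refine ⟨(LinearMap.fst R Mp A).comp (f.toLinearMap.comp k), LinearMap.ext fun x => ?_⟩
    have := LinearMap.congr_fun hk x
    simp only [LinearMap.comp_apply] at this
    simp [this]
  have hA : ∀ a : X.pr.P₁ →ₗ[R] A, ∃ k : X.pr.P₀ →ₗ[R] A, k.comp X.pr.d = a := fun a => by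
    obtain ⟨k, hk⟩ := h1 (f.symm.toLinearMap.comp ((LinearMap.inr R Mp A).comp a))
    refine ⟨(LinearMap.snd R Mp A).comp (f.toLinearMap.comp k), LinearMap.ext fun x => ?_⟩
    have := LinearMap.congr_fun hk x
    simp only [LinearMap.comp_apply] at this
    simp [this]
  have hPA : ∀ a : P →ₗ[R] A, a = 0 := fun a => LinearMap.ext fun x => by
    have := LinearMap.congr_fun (hP (f.symm.toLinearMap.comp ((LinearMap.inr R Mp A).comp a))) x
    simpa using this
  have hPMp : ∀ a : P →ₗ[R] Mp, a = 0 := fun a => LinearMap.ext fun x => by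
    have := LinearMap.congr_fun (hP (f.symm.toLinearMap.comp ((LinearMap.inl R Mp A).comp a))) x
    simpa using this
  refine ⟨isTauRigid_of_factor D.fgpQ X.pr' g fun a => ?_, fun a => LinearMap.ext fun x => ?_⟩
  · obtain ⟨k, hk⟩ := X.exists_factor_proj D hPA
      ((LinearMap.fst S P₁ T).comp (g.toLinearMap.comp a))
    obtain ⟨k', hk'⟩ := X.exists_factor_tr hA ((LinearMap.snd S P₁ T).comp (g.toLinearMap.comp a))
    refine ⟨g.symm.toLinearMap.comp (k.prod k'), LinearMap.ext fun x => g.injective ?_⟩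
    have h2 := LinearMap.congr_fun hk x
    have h3 := LinearMap.congr_fun hk' x
    simp only [LinearMap.comp_apply] at h2 h3
    simp [h2, h3]
  · refine g.injective (Prod.ext ?_ ?_)
    · obtain ⟨b, hb⟩ := DualPair.exists_adj' D E ((LinearMap.fst S P₁ T).comp (g.toLinearMap.comp a))
      have := hb.eq_zero (fun p => LinearMap.congr_fun (hPMp b) p) x
      simpa using this
    · have := LinearMap.congr_fun
        (X.hom_eq_zero E hMp ((LinearMap.snd S P₁ T).comp (g.toLinearMap.comp a))) x
      simpa using this

lemma exists_basic [IsArtinianRing R] [IsArtinianRing S] (σ : AntiIso R S) (hM : Module.Finite R M)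
    (hP : FGP R P) (hMb : IsBasic R M) (hPb : IsBasic R P) :
    ∃ (N Q : ModuleCat.{u} S), Dag σ M P N Q ∧ Module.Finite S N ∧ IsBasic S N ∧ IsBasic S Q ∧
      ∀ m p, NumIndec R M m → NumIndec R P p →
        ∃ m' p', NumIndec S N m' ∧ NumIndec S Q p' ∧ m' + p' = m + p := by
  classical
  obtain ⟨n, X, hX, hXi⟩ := hMb.exists_isDecomp
  obtain ⟨k, Z, hZ, hZi⟩ := hPb.exists_isDecomp
  obtain ⟨hX1, ⟨eX⟩⟩ := id hX
  obtain ⟨hZ1, ⟨eZ⟩⟩ := id hZ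
  have hXf := hX.finite hM
  have hZp : ∀ i, FGP R (Z i) := fun i => hP.of_retract
    (eZ.symm.toLinearMap.comp (LinearMap.single R (fun j => Z j) i))
    ((LinearMap.proj i).comp eZ.toLinearMap) (by simp)
  let pj : Fin n → Prop := fun i => Module.Projective R (X i)
  have hT : ∀ i : {i // ¬ pj i}, ∃ T : ModuleCat.{u} S, Nonempty (TrData σ (X i) T) := fun i => by
    obtain ⟨T, _, _, h⟩ := TrData.exists_of_noProj σ (hXf i) ((hX1 i).noProjSummand i.2)
    exact ⟨.of S T, h⟩
  have hQ : ∀ i : {i // pj i}, ∃ T : ModuleCat.{u} S, Nonempty (DualPair σ (X i) T) := fun i => by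
    obtain ⟨T, _, _, h⟩ := FGP.exists_dualPair σ ⟨hXf i, i.2⟩
    exact ⟨.of S T, h⟩
  have hZ' : ∀ i, ∃ T : ModuleCat.{u} S, Nonempty (DualPair σ (Z i) T) := fun i => by
    obtain ⟨T, _, _, h⟩ := FGP.exists_dualPair σ (hZp i)
    exact ⟨.of S T, h⟩
  choose T hT using hT
  choose Y hY using hQ
  choose W hW using hZ'
  obtain ⟨tr⟩ := (isDuality_trData σ).pi hT
  obtain ⟨dY⟩ := (isDuality_dualPair σ).pi hY
  obtain ⟨dW⟩ := (isDuality_dualPair σ).pi hW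
  have hTi : ∀ i, IsIndec S (T i) := fun i => (isDuality_trData σ).isIndec (hT i) (hX1 i)
  have hYi : ∀ i, IsIndec S (Y i) := fun i => (isDuality_dualPair σ).isIndec (hY i) (hX1 i)
  have hWi : ∀ i, IsIndec S (W i) := fun i => (isDuality_dualPair σ).isIndec (hW i) (hZ1 i)
  let V : Fin k ⊕ {i // ¬ pj i} → ModuleCat.{u} S := Sum.elim W T
  have hV : IsDecomp S ((∀ i, W i) × ∀ i, T i) V := by
    refine ⟨fun i => ?_, ⟨(LinearEquiv.sumPiEquivProdPi S _ _ fun i => V i).symm⟩⟩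
    rcases i with i | i
    · exact hWi i
    · exact hTi i
  have hWT : ∀ i j, ¬ Nonempty (W i ≃ₗ[S] T j) := fun i j ⟨e⟩ => by
    obtain ⟨D⟩ := hW i
    obtain ⟨E⟩ := hT j
    have h1 := E.swap.noProj.subsingleton (D.fgpQ.of_equiv e).2
    exact not_subsingleton_iff_nontrivial.2 (hTi j).1 h1
  have hVi : ∀ i j, Nonempty (V i ≃ₗ[S] V j) → i = j := by
    rintro (i | i) (j | j) ⟨e⟩
    · exact congrArg Sum.inl (hZi _ _ ((isDuality_dualPair σ).uniq' (hW i) (hW j) e))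
    · exact absurd ⟨e⟩ (hWT i j)
    · exact absurd ⟨e.symm⟩ (hWT j i)
    · exact congrArg Sum.inr
        (Subtype.ext (hXi _ _ ((isDuality_trData σ).uniq' (hT i) (hT j) e)))
  have hYd : IsDecomp S (∀ i, Y i) Y := ⟨hYi, ⟨LinearEquiv.refl S _⟩⟩
  have hYinj : ∀ i j, Nonempty (Y i ≃ₗ[S] Y j) → i = j := fun i j ⟨e⟩ =>
    Subtype.ext (hXi _ _ ((isDuality_dualPair σ).uniq' (hY i) (hY j) e))
  have hTf : Module.Finite S (∀ i, T i) := tr.pr'.finite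
  have hWf : Module.Finite S (∀ i, W i) := dW.fgpQ.1
  refine ⟨.of S ((∀ i, W i) × ∀ i, T i), .of S (∀ i, Y i),
    ⟨.of R (∀ i : {i // pj i}, X i), .of R (∀ i : {i // ¬ pj i}, X i), .of S (∀ i, T i),
      .of S (∀ i, W i), ⟨eX.trans (piSplit X pj)⟩, ⟨LinearEquiv.refl S _⟩, ⟨tr⟩,
      ⟨dW.congr eZ.symm (LinearEquiv.refl S _)⟩, ⟨dY⟩⟩,
    (inferInstance : Module.Finite S ((∀ i, W i) × ∀ i, T i)), hV.isBasic hVi,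
    hYd.isBasic hYinj, fun m p hm hp => ⟨_, _, hV.numIndec_card hVi, hYd.numIndec_card hYinj, ?_⟩⟩
  rw [hX.card_eq hM hXi hm, hZ.card_eq hP.1 hZi hp, Fintype.card_sum,
    Fintype.card_subtype_compl]
  have := Fintype.card_subtype_le pj
  omega

end Dag
end

section
variable {K R S : Type u} [Field K] [Ring R] [Algebra K R] [Ring S] [Algebra K S] {σ : AntiIso R S}

/-- The dagger relation on pairs. -/
def ModPair.Dag (σ : AntiIso R S) (x : ModPair K R) (y : ModPair K S) : Prop :=
  GPTau.Dag σ x.M x.P y.M y.P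

lemma ModPair.exists_dag [IsArtinianRing R] [IsArtinianRing S] (σ : AntiIso R S) (x : ModPair K R)
    (hx : IsBasicPair K R x) (hP : Module.Projective R x.P) :
    ∃ y : ModPair K S, x.Dag σ y ∧ IsBasicPair K S y ∧
      ∀ m p, NumIndec R x.M m → NumIndec R x.P p →
        ∃ m' p', NumIndec S y.M m' ∧ NumIndec S y.P p' ∧ m' + p' = m + p := by
  obtain ⟨N, Q, h, hN, hNb, hQb, hc⟩ := Dag.exists_basic σ x.finM ⟨x.finP, hP⟩ hx.1 hx.2
  let _ : Module K N := Module.compHom N (algebraMap K S)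
  let _ : Module K Q := Module.compHom Q (algebraMap K S)
  have : IsScalarTower K S N := ⟨fun k s n => by rw [Algebra.smul_def, mul_smul]; rfl⟩
  have : IsScalarTower K S Q := ⟨fun k s n => by rw [Algebra.smul_def, mul_smul]; rfl⟩
  exact ⟨{ M := N, finM := hN, P := Q, finP := h.fgp.1 }, h, ⟨hNb, hQb⟩, hc⟩

lemma ModPair.Dag.good [IsArtinianRing R] [IsArtinianRing S] {x : ModPair K R} {y : ModPair K S}
    (h : x.Dag σ y) (hx : IsBasicPair K R x ∧ IsGPSuppTauTiltingPair K R x) :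
    IsBasicPair K S y ∧ IsGPSuppTauTiltingPair K S y := by
  obtain ⟨hb, ⟨⟨hr, hp, h0⟩, m, p, l, hm, hp', hl, hmp⟩, hgp⟩ := hx
  obtain ⟨z, hz, hzb, hc⟩ := ModPair.exists_dag σ x hb hp
  obtain ⟨⟨e⟩, ⟨e'⟩⟩ := GPTau.Dag.unique hz h (LinearEquiv.refl R _) (LinearEquiv.refl R _)
  obtain ⟨m', p', hm', hp'', hmp'⟩ := hc m p hm hp'
  obtain ⟨h1, h2⟩ := GPTau.Dag.isTauRigidPair h K hr h0
  exact ⟨⟨hzb.1.congr e, hzb.2.congr e'⟩, ⟨⟨h1, (GPTau.Dag.fgp h).2, h2⟩, m', p', l, hm'.congr e,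
    hp''.congr e', hl.ring_of_antiIso σ, hmp'.trans hmp⟩, GPTau.Dag.isGP h hgp⟩

lemma IsDaggerOf.dag [IsArtinianRing R] {x : ModPair K R} {y : ModPair K Rᵐᵒᵖ}
    (h : IsDaggerOf K R x y) (hP : Module.Projective R x.P) : x.Dag (opAnti R) y := by
  obtain ⟨Mp, Mnp, hc, hMp, hMnp, pr, ⟨e⟩, ⟨e'⟩⟩ := h
  have := x.finM
  have hMpf : FGP R Mp := ⟨Module.Finite.of_surjective _ (Submodule.projectionOnto_surjective hc), hMp⟩
  have hPf : FGP R x.P := ⟨x.finP, hP⟩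
  obtain ⟨X⟩ := pr.nonempty_trData hMnp
  obtain ⟨D, -⟩ := hPf.exists_dualPair_op
  obtain ⟨E, -⟩ := hMpf.exists_dualPair_op
  exact ⟨.of R Mp, .of R Mnp, .of Rᵐᵒᵖ pr.Tr, .of Rᵐᵒᵖ (x.P →ₗ[R] R),
    ⟨(Submodule.prodEquivOfIsCompl Mp Mnp hc).symm⟩, ⟨e.trans (LinearEquiv.prodComm _ _ _)⟩,
    ⟨X⟩, ⟨D⟩, ⟨E.congr (LinearEquiv.refl R _) e'.symm⟩⟩

end

/-- The assignment `(M,P) ↦ (M,P)† = (Tr M_np ⊕ P*, M_p*)` is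
a bijection between the isomorphism classes of basic Gorenstein projective
support τ-tilting pairs in `mod Λ` and in `mod Λᵒᵖ`. -/
theorem gp_supp_tau_tilting_dagger_bijection (K R : Type u) [Field K] [Ring R]
    [Algebra K R] [FiniteDimensional K R] :
    ∃ e : Quotient (pairSetoid K R fun x => IsBasicPair K R x ∧
          IsGPSuppTauTiltingPair K R x) ≃
        Quotient (pairSetoid K Rᵐᵒᵖ fun y => IsBasicPair K Rᵐᵒᵖ y ∧
          IsGPSuppTauTiltingPair K Rᵐᵒᵖ y),
      ∀ (x : {x : ModPair K R // IsBasicPair K R x ∧ IsGPSuppTauTiltingPair K R x})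
        (y : {y : ModPair K Rᵐᵒᵖ // IsBasicPair K Rᵐᵒᵖ y ∧
          IsGPSuppTauTiltingPair K Rᵐᵒᵖ y}),
        IsDaggerOf K R x.1 y.1 → e (Quotient.mk _ x) = Quotient.mk _ y := by
  have hR : IsArtinianRing R := IsArtinianRing.of_finite K R
  have : FiniteDimensional K Rᵐᵒᵖ := Module.Finite.equiv (opLinearEquiv K : R ≃ₗ[K] Rᵐᵒᵖ)
  have hS : IsArtinianRing Rᵐᵒᵖ := IsArtinianRing.of_finite K Rᵐᵒᵖ
  have hex : ∀ x : {x : ModPair K R // IsBasicPair K R x ∧ IsGPSuppTauTiltingPair K R x},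
      ∃ y : {y : ModPair K Rᵐᵒᵖ // IsBasicPair K Rᵐᵒᵖ y ∧ IsGPSuppTauTiltingPair K Rᵐᵒᵖ y},
        x.1.Dag (opAnti R) y.1 := fun x => by
    obtain ⟨y, hy, -⟩ := x.1.exists_dag (opAnti R) x.2.1 x.2.2.1.1.2.1
    exact ⟨⟨y, hy.good x.2⟩, hy⟩
  choose φ hφ using hex
  let f : Quotient (pairSetoid K R fun x => IsBasicPair K R x ∧ IsGPSuppTauTiltingPair K R x) →
      Quotient (pairSetoid K Rᵐᵒᵖ fun y => IsBasicPair K Rᵐᵒᵖ y ∧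
        IsGPSuppTauTiltingPair K Rᵐᵒᵖ y) :=
    Quotient.map φ fun a b ⟨⟨e⟩, ⟨e'⟩⟩ => GPTau.Dag.unique (hφ a) (hφ b) e e'
  have hf : Bijective f := by
    constructor
    · rintro ⟨a⟩ ⟨b⟩ hab
      obtain ⟨⟨e⟩, ⟨e'⟩⟩ := Quotient.exact hab
      exact Quotient.sound (GPTau.Dag.unique (hφ a).symm (hφ b).symm e e')
    · rintro ⟨y⟩
      obtain ⟨x, hx, -⟩ := y.1.exists_dag (opAnti R).symm y.2.1 y.2.2.1.1.2.1
      refine ⟨Quotient.mk _ ⟨x, hx.good y.2⟩, Quotient.sound ?_⟩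
      exact GPTau.Dag.unique (hφ _) hx.symm (LinearEquiv.refl R _) (LinearEquiv.refl R _)
  exact ⟨Equiv.ofBijective f hf, fun x y hxy => Quotient.sound
    (GPTau.Dag.unique (hφ x) (hxy.dag x.2.2.1.1.2.1) (LinearEquiv.refl R _) (LinearEquiv.refl R _))⟩

end GPTau
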